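/- arXiv:2107.12439 — 4 statements merged into one kernel-verified Lean document; each statement's English description precedes it below -/
import Mathlib

section
/- Fix σ₀ > 0. For every real u > 0, the SABR payoff function satisfies 0 ≤ g(u) ≤ √2 · σ₀ · u · cosh(u/2). -/
open scoped Real

/-- The SABR payoff function
`g(u) = sinh u · ∫_0^u sin((σ₀/2) sinh s) / (sinh s · √(cosh u − cosh s)) ds`. -/
noncomputable def sabrPayoff (σ₀ u : ℝ) : ℝ :=
  Real.sinh u *
    ∫ s in (0 : ℝ)..u,
      Real.sin (σ₀ / 2 * Real.sinh s) /
        (Real.sinh s * Real.sqrt (Real.cosh u - Real.cosh s))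

open MeasureTheory Set intervalIntegral

/-- A continuous function whose primitive is nonnegative stays of nonnegative integral after
multiplication by a nonnegative nonincreasing weight. -/
lemma integral_antitone_mul_nonneg {D D' f : ℝ → ℝ} {u : ℝ} (hu : 0 ≤ u) (hD : Continuous D)
    (hderiv : ∀ s ∈ Ioo 0 u, HasDerivAt D (D' s) s) (hneg : ∀ s ∈ Ioo 0 u, D' s ≤ 0)
    (hDu : 0 ≤ D u) (hf : Continuous f) (hprim : ∀ ξ ∈ Icc 0 u, 0 ≤ ∫ s in (0 : ℝ)..ξ, f s) :
    0 ≤ ∫ s in (0 : ℝ)..u, D s * f s := by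
  have hDf : Continuous fun s => D s * f s := hD.mul hf
  have hd1 : ∀ b, HasDerivAt (fun b => ∫ s in (0 : ℝ)..b, D s * f s) (D b * f b) b :=
    fun b => hDf.integral_hasStrictDerivAt 0 b |>.hasDerivAt
  have hd2 : ∀ b, HasDerivAt (fun b => ∫ s in (0 : ℝ)..b, f s) (f b) b :=
    fun b => hf.integral_hasStrictDerivAt 0 b |>.hasDerivAt
  have hd : ∀ b ∈ Ioo 0 u, HasDerivAt
      (fun b => (∫ s in (0 : ℝ)..b, D s * f s) - D b * ∫ s in (0 : ℝ)..b, f s)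
      (D b * f b - (D' b * (∫ s in (0 : ℝ)..b, f s) + D b * f b)) b :=
    fun b hb => (hd1 b).sub ((hderiv b hb).mul (hd2 b))
  have hmono : MonotoneOn
      (fun b => (∫ s in (0 : ℝ)..b, D s * f s) - D b * ∫ s in (0 : ℝ)..b, f s) (Icc 0 u) := by
    apply monotoneOn_of_deriv_nonneg (convex_Icc 0 u)
    · exact ((continuous_iff_continuousAt.2 fun b => (hd1 b).continuousAt).sub
        (hD.mul (continuous_iff_continuousAt.2 fun b => (hd2 b).continuousAt))).continuousOn
    · rw [interior_Icc]
      exact fun b hb => (hd b hb).differentiableAt.differentiableWithinAt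
    · rw [interior_Icc]
      intro b hb
      rw [(hd b hb).deriv]
      nlinarith [mul_nonneg (neg_nonneg.2 (hneg b hb)) (hprim b ⟨hb.1.le, hb.2.le⟩)]
  have h := hmono (left_mem_Icc.2 hu) (right_mem_Icc.2 hu) hu
  simp only [integral_same, mul_zero, sub_zero] at h
  nlinarith [mul_nonneg hDu (hprim u (right_mem_Icc.2 hu))]

/-- The sine integral. -/
noncomputable def sineIntegral (y : ℝ) : ℝ := ∫ t in (0 : ℝ)..y, Real.sinc t

lemma hasDerivAt_sineIntegral (y : ℝ) : HasDerivAt sineIntegral (Real.sinc y) y :=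
  (Real.continuous_sinc.integral_hasStrictDerivAt 0 y).hasDerivAt

lemma one_sub_cos_div_eq (y : ℝ) :
    (1 - Real.cos y) / y = Real.sin (y / 2) * Real.sinc (y / 2) := by
  rcases eq_or_ne y 0 with rfl | hy
  · simp
  · have h : Real.cos y = 1 - 2 * Real.sin (y / 2) ^ 2 := by
      have h2 := Real.cos_two_mul (y / 2)
      rw [mul_div_cancel₀ y two_ne_zero] at h2
      rw [h2, Real.cos_sq']
      ring
    rw [Real.sinc_of_ne_zero (by simpa using hy), h]
    field_simp
    ring

lemma quartic_le_one_sub_cos {y : ℝ} (h0 : 0 ≤ y) (h3 : y ≤ 3) :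
    y ^ 2 / 2 - y ^ 4 / 24 ≤ 1 - Real.cos y := by
  have h2 := Real.cos_two_mul (y / 2)
  rw [mul_div_cancel₀ y two_ne_zero, Real.cos_sq'] at h2
  have hs := Real.sin_ge_sub_cube (x := y / 2) (by linarith)
  have hpos : 0 ≤ y / 2 - (y / 2) ^ 3 / 6 := by
    nlinarith [mul_nonneg h0 (sub_nonneg.2 h3), mul_nonneg h0 (mul_nonneg h0 (sub_nonneg.2 h3))]
  have hsq := pow_le_pow_left₀ hpos hs 2
  nlinarith [sq_nonneg (y ^ 3)]

lemma continuous_sineIntegral_sub :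
    Continuous fun y => sineIntegral y - (1 - Real.cos y) / y := by
  simp only [one_sub_cos_div_eq]
  exact (continuous_iff_continuousAt.2 fun y => (hasDerivAt_sineIntegral y).continuousAt).sub
    ((Real.continuous_sin.comp (continuous_id.div_const 2)).mul
      (Real.continuous_sinc.comp (continuous_id.div_const 2)))

lemma hasDerivAt_sineIntegral_sub {y : ℝ} (hy : y ≠ 0) :
    HasDerivAt (fun y => sineIntegral y - (1 - Real.cos y) / y) ((1 - Real.cos y) / y ^ 2) y := by
  have h := (hasDerivAt_sineIntegral y).sub
    (((Real.hasDerivAt_cos y).const_sub 1).div (hasDerivAt_id y) hy)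
  refine h.congr_deriv ?_
  rw [Real.sinc_of_ne_zero hy]
  simp only [id]
  field_simp
  ring

lemma one_le_sineIntegral {y : ℝ} (hy : 3 ≤ y) : 1 ≤ sineIntegral y := by
  have hmono : MonotoneOn (fun y => sineIntegral y - (1 - Real.cos y) / y) (Ici 3) := by
    apply monotoneOn_of_deriv_nonneg (convex_Ici 3) continuous_sineIntegral_sub.continuousOn
    all_goals
      rw [interior_Ici]
      intro x hx
      have hd := hasDerivAt_sineIntegral_sub (y := x) (by linarith [mem_Ioi.1 hx])
    · exact hd.differentiableAt.differentiableWithinAt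
    · rw [hd.deriv]
      exact div_nonneg (by linarith [Real.cos_le_one x]) (sq_nonneg x)
  have hmono' : MonotoneOn
      (fun y => sineIntegral y - (1 - Real.cos y) / y - (y / 2 - y ^ 3 / 72)) (Icc 0 3) := by
    apply monotoneOn_of_deriv_nonneg (convex_Icc 0 3)
      (continuous_sineIntegral_sub.sub (by fun_prop)).continuousOn
    all_goals
      rw [interior_Icc]
      intro x hx
      have hd := (hasDerivAt_sineIntegral_sub (y := x) hx.1.ne').sub
        (((hasDerivAt_id x).div_const 2).sub (((hasDerivAt_id x).pow 3).div_const 72))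
    · exact hd.differentiableAt.differentiableWithinAt
    · refine hd.deriv.ge.trans' ?_
      rw [sub_nonneg, le_div_iff₀ (pow_pos hx.1 2)]
      refine le_trans (le_of_eq ?_) (quartic_le_one_sub_cos hx.1.le hx.2.le)
      simp only [id]
      push_cast
      ring
  have h1 := hmono (mem_Ici.2 le_rfl) (mem_Ici.2 hy) hy
  have h2 := hmono' (left_mem_Icc.2 (by norm_num)) (right_mem_Icc.2 (by norm_num)) (by norm_num)
  have h3 : 0 ≤ (1 - Real.cos y) / y :=
    div_nonneg (by linarith [Real.cos_le_one y]) (by linarith)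
  have h4 : sineIntegral 0 = 0 := integral_same
  simp only [h4] at h1 h2
  norm_num at h2
  linarith

lemma sineIntegral_nonneg {y : ℝ} (hy : 0 ≤ y) : 0 ≤ sineIntegral y := by
  rcases le_total y 3 with h3 | h3
  · refine integral_nonneg hy fun t ht => ?_
    rw [Real.sinc_apply]
    split_ifs
    · exact zero_le_one
    · exact div_nonneg (Real.sin_nonneg_of_nonneg_of_le_pi ht.1
        (by linarith [ht.2, Real.pi_gt_three])) ht.1
  · linarith [one_le_sineIntegral h3]

lemma sineIntegral_add_sin_nonneg {y : ℝ} (hy : 0 ≤ y) : 0 ≤ sineIntegral y + Real.sin y := by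
  rcases le_total y 3 with h3 | h3
  · exact add_nonneg (sineIntegral_nonneg hy)
      (Real.sin_nonneg_of_nonneg_of_le_pi hy (by linarith [Real.pi_gt_three]))
  · linarith [one_le_sineIntegral h3, Real.neg_one_le_sin y]

lemma integral_cosh_mul_sinc (a ξ : ℝ) :
    ∫ s in (0 : ℝ)..ξ, a * Real.cosh s * Real.sinc (a * Real.sinh s) =
      sineIntegral (a * Real.sinh ξ) := by
  have h := integral_comp_mul_deriv (a := 0) (b := ξ) (f := fun s => a * Real.sinh s)
    (f' := fun s => a * Real.cosh s) (g := Real.sinc)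
    (fun x _ => (Real.hasDerivAt_sinh x).const_mul a) (by fun_prop) Real.continuous_sinc
  simp only [Real.sinh_zero, mul_zero] at h
  rw [sineIntegral, ← h]
  exact integral_congr fun s _ => mul_comm _ _

lemma integral_cosh_sub_mul_sinc_nonneg {a ξ u : ℝ} (ha : 0 ≤ a) (hξ : 0 ≤ ξ) (hξu : ξ ≤ u) :
    0 ≤ ∫ s in (0 : ℝ)..ξ,
      (Real.cosh u - Real.cosh s) / Real.cosh s *
        (a * Real.cosh s * Real.sinc (a * Real.sinh s)) := by
  have hc : ∀ s, Real.cosh s ≠ 0 := fun s => (Real.cosh_pos s).ne'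
  refine integral_antitone_mul_nonneg hξ
    ((continuous_const.sub Real.continuous_cosh).div Real.continuous_cosh hc)
    (fun s _ => ((Real.hasDerivAt_cosh s).const_sub _).div (Real.hasDerivAt_cosh s) (hc s))
    (fun s hs => ?_) (div_nonneg (sub_nonneg.2 ?_) (Real.cosh_pos ξ).le)
    ?_ fun ζ hζ => ?_
  · refine div_nonpos_of_nonpos_of_nonneg ?_ (sq_nonneg _)
    nlinarith [mul_nonneg (Real.sinh_nonneg_iff.2 hs.1.le) (Real.cosh_pos u).le]
  · rw [Real.cosh_le_cosh, abs_of_nonneg hξ]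
    exact hξu.trans (le_abs_self u)
  · exact (continuous_const.mul Real.continuous_cosh).mul
      (Real.continuous_sinc.comp (continuous_const.mul Real.continuous_sinh))
  · rw [integral_cosh_mul_sinc]
    exact sineIntegral_nonneg (mul_nonneg ha (Real.sinh_nonneg_iff.2 hζ.1))

lemma integral_sinc_add_cos_nonneg {a ξ u : ℝ} (ha : 0 ≤ a) (hξ : 0 ≤ ξ) (hξu : ξ ≤ u) :
    0 ≤ ∫ s in (0 : ℝ)..ξ,
      ((Real.cosh u + Real.cosh s) * (a * Real.sinc (a * Real.sinh s)) +
        2 * (Real.cos (a * Real.sinh s) * (a * Real.cosh s))) := by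
  have hsinc : Continuous fun s => Real.sinc (a * Real.sinh s) :=
    Real.continuous_sinc.comp (continuous_const.mul Real.continuous_sinh)
  have hc : ∀ s, Real.cosh s ≠ 0 := fun s => (Real.cosh_pos s).ne'
  have hsin : ∫ s in (0 : ℝ)..ξ, Real.cos (a * Real.sinh s) * (a * Real.cosh s) =
      Real.sin (a * Real.sinh ξ) := by
    rw [integral_eq_sub_of_hasDerivAt (f := fun s => Real.sin (a * Real.sinh s))
      (fun s _ => ((Real.hasDerivAt_sinh s).const_mul a).sin)
      (Continuous.intervalIntegrable (by fun_prop) _ _)]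
    simp
  have hsplit : ∀ s, (Real.cosh u + Real.cosh s) * (a * Real.sinc (a * Real.sinh s)) +
        2 * (Real.cos (a * Real.sinh s) * (a * Real.cosh s)) =
      (Real.cosh u - Real.cosh s) / Real.cosh s *
        (a * Real.cosh s * Real.sinc (a * Real.sinh s)) +
      2 * (a * Real.cosh s * Real.sinc (a * Real.sinh s)) +
      2 * (Real.cos (a * Real.sinh s) * (a * Real.cosh s)) := by
    intro s
    have := hc s
    field_simp
    ring
  have hi1 : Continuous fun s => (Real.cosh u - Real.cosh s) / Real.cosh s *
        (a * Real.cosh s * Real.sinc (a * Real.sinh s)) := by fun_prop (disch := exact hc _)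
  have hi2 : Continuous fun s => 2 * (a * Real.cosh s * Real.sinc (a * Real.sinh s)) := by
    fun_prop
  have hi12 : Continuous fun s => (Real.cosh u - Real.cosh s) / Real.cosh s *
        (a * Real.cosh s * Real.sinc (a * Real.sinh s)) +
      2 * (a * Real.cosh s * Real.sinc (a * Real.sinh s)) := hi1.add hi2
  have hi3 : Continuous fun s => 2 * (Real.cos (a * Real.sinh s) * (a * Real.cosh s)) := by
    fun_prop
  simp only [hsplit]
  rw [integral_add (hi12.intervalIntegrable _ _) (hi3.intervalIntegrable _ _),
    integral_add (hi1.intervalIntegrable _ _) (hi2.intervalIntegrable _ _),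
    intervalIntegral.integral_const_mul, intervalIntegral.integral_const_mul,
    integral_cosh_mul_sinc, hsin]
  linarith [integral_cosh_sub_mul_sinc_nonneg ha hξ hξu,
    sineIntegral_add_sin_nonneg (mul_nonneg ha (Real.sinh_nonneg_iff.2 hξ))]

lemma cosh_sub_cosh_pos {s u : ℝ} (hs : s ∈ Ioo 0 u) : 0 < Real.cosh u - Real.cosh s := by
  rw [sub_pos, Real.cosh_lt_cosh, abs_of_pos hs.1]
  exact hs.2.trans_le (le_abs_self u)

lemma cosh_sub_cosh_ge {s u : ℝ} (hs : s ∈ Ioo 0 u) :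
    (Real.cosh u - 1) * (1 - s / u) ≤ Real.cosh u - Real.cosh s := by
  have hu : 0 < u := hs.1.trans hs.2
  have h0 : 0 ≤ 1 - s / u := by
    rw [sub_nonneg, div_le_one hu]
    exact hs.2.le
  have h : ∀ v, Real.exp (s / u * v) ≤ 1 - s / u + s / u * Real.exp v := fun v => by
    simpa using convexOn_exp.2 (mem_univ 0) (mem_univ v) h0 (div_nonneg hs.1.le hu.le)
      (sub_add_cancel _ _)
  have h1 := h u
  have h2 := h (-u)
  rw [mul_neg, div_mul_cancel₀ s hu.ne'] at h2
  rw [div_mul_cancel₀ s hu.ne'] at h1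
  rw [Real.cosh_eq, Real.cosh_eq]
  linarith

lemma hasDerivAt_neg_two_mul_sqrt {u s : ℝ} (hs : s ∈ Ioo 0 u) :
    HasDerivAt (fun s => -(2 * u) * √(1 - s / u)) (1 / √(1 - s / u)) s := by
  have hu : 0 < u := hs.1.trans hs.2
  have hpos : 0 < 1 - s / u := by rw [sub_pos, div_lt_one hu]; exact hs.2
  have hne := (Real.sqrt_pos.2 hpos).ne'
  refine (((((hasDerivAt_id s).div_const u).const_sub 1).sqrt hpos.ne').const_mul
    (-(2 * u))).congr_deriv ?_
  simp only [id]
  field_simp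

lemma intervalIntegrable_one_div_sqrt {u : ℝ} (hu : 0 < u) :
    IntervalIntegrable (fun s => 1 / √(1 - s / u)) volume 0 u := by
  rw [intervalIntegrable_iff_integrableOn_Ioc_of_le hu.le]
  exact integrableOn_deriv_of_nonneg (g := fun s => -(2 * u) * √(1 - s / u))
    (Continuous.continuousOn (by fun_prop)) (fun s hs => hasDerivAt_neg_two_mul_sqrt hs)
    fun s _ => by positivity

lemma integral_one_div_sqrt {u : ℝ} (hu : 0 < u) :
    ∫ s in (0 : ℝ)..u, 1 / √(1 - s / u) = 2 * u := by
  rw [integral_eq_sub_of_hasDerivAt_of_le hu.le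
    (Continuous.continuousOn (f := fun s => -(2 * u) * √(1 - s / u)) (by fun_prop))
    (fun s hs => hasDerivAt_neg_two_mul_sqrt hs) (intervalIntegrable_one_div_sqrt hu)]
  simp [hu.ne']

lemma one_div_sqrt_cosh_sub_le {s u : ℝ} (hs : s ∈ Ioo 0 u) :
    1 / √(Real.cosh u - Real.cosh s) ≤ 1 / √(Real.cosh u - 1) * (1 / √(1 - s / u)) := by
  have hu : 0 < u := hs.1.trans hs.2
  have hpos : 0 < 1 - s / u := by rw [sub_pos, div_lt_one hu]; exact hs.2
  have hC : 0 < Real.cosh u - 1 := sub_pos.2 (Real.one_lt_cosh.2 hu.ne')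
  rw [one_div_mul_one_div, ← Real.sqrt_mul hC.le]
  exact one_div_le_one_div_of_le (Real.sqrt_pos.2 (mul_pos hC hpos))
    (Real.sqrt_le_sqrt (cosh_sub_cosh_ge hs))

lemma intervalIntegrable_one_div_sqrt_cosh_sub {u : ℝ} (hu : 0 < u) :
    IntervalIntegrable (fun s => 1 / √(Real.cosh u - Real.cosh s)) volume 0 u := by
  refine ((intervalIntegrable_one_div_sqrt hu).const_mul
    (1 / √(Real.cosh u - 1))).mono_fun' ?_ ?_
  · exact (Measurable.aestronglyMeasurable (by fun_prop))
  · rw [uIoc_of_le hu.le, ← Measure.restrict_congr_set Ioo_ae_eq_Ioc]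
    filter_upwards [ae_restrict_mem measurableSet_Ioo] with s hs
    rw [Real.norm_of_nonneg (by positivity)]
    exact one_div_sqrt_cosh_sub_le hs

lemma integral_one_div_sqrt_cosh_sub_le {u : ℝ} (hu : 0 < u) :
    ∫ s in (0 : ℝ)..u, 1 / √(Real.cosh u - Real.cosh s) ≤
      1 / √(Real.cosh u - 1) * (2 * u) := by
  rw [← integral_one_div_sqrt hu, ← intervalIntegral.integral_const_mul]
  exact integral_mono_on_of_le_Ioo hu.le (intervalIntegrable_one_div_sqrt_cosh_sub hu)
    ((intervalIntegrable_one_div_sqrt hu).const_mul _) fun s hs => one_div_sqrt_cosh_sub_le hs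

/-- On `(0, u)` the integrand of the payoff is a continuous function divided by the square root. -/
lemma sabrPayoff_eq {σ₀ u : ℝ} (hu : 0 < u) :
    sabrPayoff σ₀ u = Real.sinh u * ∫ s in (0 : ℝ)..u,
      σ₀ / 2 * Real.sinc (σ₀ / 2 * Real.sinh s) * (1 / √(Real.cosh u - Real.cosh s)) := by
  rw [sabrPayoff]
  congr 1
  refine integral_congr_Ioo_of_le hu.le fun s hs => ?_
  have hx : Real.sinh s ≠ 0 := (Real.sinh_pos_iff.2 hs.1).ne'
  rcases eq_or_ne σ₀ 0 with rfl | hσ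
  · simp
  have hr := (Real.sqrt_pos.2 (cosh_sub_cosh_pos hs)).ne'
  rw [Real.sinc_of_ne_zero (by positivity)]
  field_simp

lemma intervalIntegrable_sinc_div_sqrt {a u : ℝ} (hu : 0 < u) :
    IntervalIntegrable (fun s => a * Real.sinc (a * Real.sinh s) *
      (1 / √(Real.cosh u - Real.cosh s))) volume 0 u :=
  (intervalIntegrable_one_div_sqrt_cosh_sub hu).continuousOn_mul
    (continuous_const.mul (Real.continuous_sinc.comp
      (continuous_const.mul Real.continuous_sinh))).continuousOn

lemma hasDerivAt_sqrt_cosh_sub {s u : ℝ} (hs : s ∈ Ioo 0 u) :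
    HasDerivAt (fun s => √(Real.cosh u - Real.cosh s))
      (-Real.sinh s / (2 * √(Real.cosh u - Real.cosh s))) s :=
  ((Real.hasDerivAt_cosh s).const_sub _).sqrt (cosh_sub_cosh_pos hs).ne'

lemma integral_sinc_div_sqrt_nonneg {a u : ℝ} (ha : 0 < a) (hu : 0 < u) :
    0 ≤ ∫ s in (0 : ℝ)..u,
      a * Real.sinc (a * Real.sinh s) * (1 / √(Real.cosh u - Real.cosh s)) := by
  have hX : 0 < Real.sinh u := Real.sinh_pos_iff.2 hu
  have hsinc : Continuous fun s => Real.sinc (a * Real.sinh s) :=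
    Real.continuous_sinc.comp (continuous_const.mul Real.continuous_sinh)
  set D : ℝ → ℝ := fun s => √(Real.cosh u - Real.cosh s) with hD
  set f : ℝ → ℝ := fun s =>
    (Real.cosh u + Real.cosh s) * (a * Real.sinc (a * Real.sinh s)) +
      2 * (Real.cos (a * Real.sinh s) * (a * Real.cosh s)) with hf
  set G : ℝ → ℝ := fun s =>
    a * Real.sinc (a * Real.sinh s) * (1 / √(Real.cosh u - Real.cosh s)) with hG
  have hDc : Continuous D := by fun_prop
  have hfc : Continuous f := by fun_prop
  have hGi : IntervalIntegrable G volume 0 u := intervalIntegrable_sinc_div_sqrt hu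
  have hDfi : IntervalIntegrable (fun s => D s * f s) volume 0 u :=
    (hDc.mul hfc).intervalIntegrable _ _
  have hnonneg : 0 ≤ ∫ s in (0 : ℝ)..u, D s * f s := by
    refine integral_antitone_mul_nonneg hu.le hDc (fun s hs => hasDerivAt_sqrt_cosh_sub hs)
      (fun s hs => ?_) (Real.sqrt_nonneg _) hfc
      fun ξ hξ => integral_sinc_add_cos_nonneg ha.le hξ.1 hξ.2
    exact div_nonpos_of_nonpos_of_nonneg
      (neg_nonpos.2 (Real.sinh_nonneg_iff.2 hs.1.le)) (by positivity)
  have hparts : ∫ s in (0 : ℝ)..u, (Real.sinh u ^ 2 * G s - D s * f s) = 0 := by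
    rw [integral_eq_sub_of_hasDerivAt_of_le (f := fun s => -2 * (D s * Real.sin (a * Real.sinh s)))
      hu.le (by fun_prop) (fun s hs => ?_) ((hGi.const_mul _).sub hDfi)]
    · simp [hD]
    · have hx : Real.sinh s ≠ 0 := (Real.sinh_pos_iff.2 hs.1).ne'
      have hpos := cosh_sub_cosh_pos hs
      have hr := (Real.sqrt_pos.2 hpos).ne'
      refine (((hasDerivAt_sqrt_cosh_sub hs).mul
        ((Real.hasDerivAt_sinh s).const_mul a).sin).const_mul (-2)).congr_deriv ?_
      simp only [hD, hf, hG]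
      rw [Real.sinc_of_ne_zero (by positivity)]
      have hsq := Real.sq_sqrt hpos.le
      have h1 := Real.sinh_sq u
      have h2 := Real.sinh_sq s
      set r := √(Real.cosh u - Real.cosh s)
      field_simp
      rw [hsq, h1]
      linear_combination Real.sin (Real.sinh s * a) * h2
  rw [intervalIntegral.integral_sub (hGi.const_mul _) hDfi,
    intervalIntegral.integral_const_mul] at hparts
  exact nonneg_of_mul_nonneg_right (by linarith) (pow_pos hX 2)

/-- For `σ₀ > 0` and `u > 0`, the SABR payoff satisfies
`0 ≤ g(u) ≤ √2 σ₀ u cosh(u/2)`. -/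
theorem sabrPayoff_bounds (σ₀ : ℝ) (hσ₀ : 0 < σ₀) (u : ℝ) (hu : 0 < u) :
    0 ≤ sabrPayoff σ₀ u ∧
      sabrPayoff σ₀ u ≤ Real.sqrt 2 * σ₀ * u * Real.cosh (u / 2) := by
  have hX : 0 < Real.sinh u := Real.sinh_pos_iff.2 hu
  rw [sabrPayoff_eq hu]
  refine ⟨mul_nonneg hX.le (integral_sinc_div_sqrt_nonneg (half_pos hσ₀) hu), ?_⟩
  have hle : ∫ s in (0 : ℝ)..u, σ₀ / 2 * Real.sinc (σ₀ / 2 * Real.sinh s) *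
      (1 / √(Real.cosh u - Real.cosh s)) ≤
      σ₀ / 2 * (1 / √(Real.cosh u - 1) * (2 * u)) := by
    refine le_trans (integral_mono_on hu.le (intervalIntegrable_sinc_div_sqrt hu)
      ((intervalIntegrable_one_div_sqrt_cosh_sub hu).const_mul (σ₀ / 2)) fun s _ => ?_) ?_
    · exact mul_le_mul_of_nonneg_right
        (mul_le_of_le_one_right (half_pos hσ₀).le (Real.sinc_le_one _)) (by positivity)
    · rw [intervalIntegral.integral_const_mul]
      exact mul_le_mul_of_nonneg_left (integral_one_div_sqrt_cosh_sub_le hu) (half_pos hσ₀).le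
  refine (mul_le_mul_of_nonneg_left hle hX.le).trans (le_of_eq ?_)
  have hS : 0 < Real.sinh (u / 2) := Real.sinh_pos_iff.2 (half_pos hu)
  have hsinh : Real.sinh u = 2 * Real.sinh (u / 2) * Real.cosh (u / 2) := by
    rw [← Real.sinh_two_mul, mul_div_cancel₀ u two_ne_zero]
  have hcosh : Real.cosh u - 1 = 2 * Real.sinh (u / 2) ^ 2 := by
    have h := Real.cosh_two_mul (u / 2)
    rw [mul_div_cancel₀ u two_ne_zero, Real.cosh_sq] at h
    linarith
  rw [hcosh, Real.sqrt_mul zero_le_two, Real.sqrt_sq hS.le, hsinh]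
  have h2 : √(2 : ℝ) ^ 2 = 2 := Real.sq_sqrt zero_le_two
  field_simp
  rw [h2]
end

section
/- As y → π from the left, ∫_0^y dt/√(cos t − cos y) = √2 · log(8/(π − y)) + O(π − y); i.e., the function y ↦ ∫_0^y dt/√(cos t − cos y) − √2·log(8/(π − y)) is O(π − y) as y → π⁻. -/
open scoped Real Topology

/-- The function `h` in the sandwich `h ≤ g` and `(1 - cos² (y/2)) g ≤ h` for
`g t = 1 / √(cos t - cos y)`. -/
noncomputable def invSqrtCosComparison (y t : ℝ) : ℝ :=
  Real.sqrt 2 / 2 * (Real.sin (t / 2) / Real.sqrt (Real.cos (t / 2) ^ 2 - Real.cos (y / 2) ^ 2)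
    + Real.cos (t / 2) / (1 + Real.sin (t / 2)))

/-- An antiderivative of `invSqrtCosComparison y` on `(0, y)`. -/
noncomputable def invSqrtCosPrimitive (y t : ℝ) : ℝ :=
  Real.sqrt 2 * (Real.log (1 + Real.sin (t / 2)) -
    Real.log (Real.cos (t / 2) + Real.sqrt (Real.cos (t / 2) ^ 2 - Real.cos (y / 2) ^ 2)))

lemma cos_half_lt_cos_half {y t : ℝ} (hy : y < π) (ht : 0 ≤ t) (hty : t < y) :
    Real.cos (y / 2) < Real.cos (t / 2) :=
  Real.cos_lt_cos_of_nonneg_of_le_pi (by linarith) (by linarith [Real.pi_pos]) (by linarith)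

lemma cos_half_pos {y : ℝ} (h0 : 0 ≤ y) (hy : y < π) : 0 < Real.cos (y / 2) :=
  Real.cos_pos_of_mem_Ioo ⟨by linarith [Real.pi_pos], by linarith⟩

lemma sin_half_nonneg {y : ℝ} (h0 : 0 ≤ y) (hy : y < π) : 0 ≤ Real.sin (y / 2) :=
  Real.sin_nonneg_of_nonneg_of_le_pi (by linarith) (by linarith [Real.pi_pos])

lemma hasDerivAt_invSqrtCosPrimitive {y t : ℝ} (hy : y < π) (ht : 0 ≤ t) (hty : t < y) :
    HasDerivAt (invSqrtCosPrimitive y) (invSqrtCosComparison y t) t := by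
  have hlt := cos_half_lt_cos_half hy ht hty
  have hc := cos_half_pos (ht.trans hty.le) hy
  have hs := sin_half_nonneg ht (hty.trans hy)
  have hd : 0 < Real.cos (t / 2) ^ 2 - Real.cos (y / 2) ^ 2 := by nlinarith
  have hr := Real.sqrt_pos.2 hd
  have hp : 0 < Real.cos (t / 2) := hc.trans hlt
  have h2 : HasDerivAt (fun t : ℝ => t / 2) (1 / 2) t := (hasDerivAt_id t).div_const 2
  have hsin := h2.sin
  have hcos := h2.cos
  have hroot := ((hcos.pow 2).sub_const (Real.cos (y / 2) ^ 2)).sqrt hd.ne'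
  have h := (((hsin.const_add 1).log (by positivity)).sub
    ((hcos.add hroot).log (by simp only [Pi.add_apply, Pi.pow_apply]; positivity))).const_mul
      (Real.sqrt 2)
  refine h.congr_deriv ?_
  simp only [invSqrtCosComparison, Pi.add_apply, Pi.pow_apply]
  set r := Real.sqrt (Real.cos (t / 2) ^ 2 - Real.cos (y / 2) ^ 2)
  have h1 : 1 + Real.sin (t / 2) ≠ 0 := by positivity
  have h3 : Real.cos (t / 2) + r ≠ 0 := by positivity
  field_simp
  push_cast
  ring

lemma continuousOn_invSqrtCosPrimitive {y : ℝ} (hy : y < π) :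
    ContinuousOn (invSqrtCosPrimitive y) (Set.Icc 0 y) := by
  refine ContinuousOn.mul continuousOn_const (ContinuousOn.sub ?_ ?_)
  · refine ContinuousOn.log (by fun_prop) fun t ht => ?_
    have := sin_half_nonneg ht.1 (ht.2.trans_lt hy)
    positivity
  · refine ContinuousOn.log (by fun_prop) fun t ht => ?_
    have := cos_half_pos ht.1 (ht.2.trans_lt hy)
    positivity

lemma one_div_sqrt_cos_sub_cos (y t : ℝ) :
    1 / Real.sqrt (Real.cos t - Real.cos y) =
      Real.sqrt 2 / 2 * (1 / Real.sqrt (Real.cos (t / 2) ^ 2 - Real.cos (y / 2) ^ 2)) := by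
  have h : Real.cos t - Real.cos y = 2 * (Real.cos (t / 2) ^ 2 - Real.cos (y / 2) ^ 2) := by
    rw [Real.cos_sq, Real.cos_sq, mul_div_cancel₀ t two_ne_zero, mul_div_cancel₀ y two_ne_zero]
    ring
  rw [h, Real.sqrt_mul (by norm_num), Real.sqrt_div_self', one_div_mul_one_div]

lemma invSqrtCosComparison_nonneg {y t : ℝ} (hy : y < π) (ht : 0 ≤ t) (hty : t < y) :
    0 ≤ invSqrtCosComparison y t := by
  have hs := sin_half_nonneg ht (hty.trans hy)
  have hp := cos_half_pos ht (hty.trans hy)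
  unfold invSqrtCosComparison
  positivity

lemma invSqrtCosComparison_bounds {y t : ℝ} (hy : y < π) (ht : 0 ≤ t) (hty : t < y) :
    invSqrtCosComparison y t ≤ 1 / Real.sqrt (Real.cos t - Real.cos y) ∧
    (1 - Real.cos (y / 2) ^ 2) * (1 / Real.sqrt (Real.cos t - Real.cos y)) ≤
      invSqrtCosComparison y t := by
  have hlt := cos_half_lt_cos_half hy ht hty
  have hc := cos_half_pos (ht.trans hty.le) hy
  have hs := sin_half_nonneg ht (hty.trans hy)
  have hd : 0 < Real.cos (t / 2) ^ 2 - Real.cos (y / 2) ^ 2 := by nlinarith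
  have hr := Real.sqrt_pos.2 hd
  have hr2 := Real.sq_sqrt hd.le
  have hp : 0 < Real.cos (t / 2) := hc.trans hlt
  have hsc := Real.sin_sq_add_cos_sq (t / 2)
  rw [one_div_sqrt_cos_sub_cos, invSqrtCosComparison, mul_left_comm]
  set r := Real.sqrt (Real.cos (t / 2) ^ 2 - Real.cos (y / 2) ^ 2)
  set p := Real.cos (t / 2)
  set s := Real.sin (t / 2)
  set c := Real.cos (y / 2)
  have hrp : r ≤ p := by nlinarith
  have key : 1 / r - (s / r + p / (1 + s)) = p * (p - r) / (r * (1 + s)) := by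
    field_simp
    linear_combination -hsc
  constructor
  · refine mul_le_mul_of_nonneg_left ?_ (by positivity)
    rw [← sub_nonneg, key]
    exact div_nonneg (mul_nonneg hp.le (sub_nonneg.2 hrp)) (by positivity)
  · refine mul_le_mul_of_nonneg_left ?_ (by positivity)
    have h : p * (p - r) / (r * (1 + s)) ≤ c ^ 2 * (1 / r) := by
      rw [mul_one_div, div_le_div_iff₀ (by positivity) hr]
      have : p * (p - r) ≤ c ^ 2 := by nlinarith
      nlinarith [mul_le_mul_of_nonneg_right this hr.le,
        mul_nonneg (mul_nonneg (sq_nonneg c) hr.le) hs]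
    linarith

lemma invSqrtCosPrimitive_sub {y : ℝ} (h0 : 0 ≤ y) (hy : y < π) :
    invSqrtCosPrimitive y y - invSqrtCosPrimitive y 0 =
      Real.sqrt 2 * (2 * Real.log (1 + Real.sin (y / 2)) - Real.log (Real.cos (y / 2))) := by
  have h : Real.sqrt (1 - Real.cos (y / 2) ^ 2) = Real.sin (y / 2) := by
    rw [← Real.sin_sq, Real.sqrt_sq (sin_half_nonneg h0 hy)]
  simp [invSqrtCosPrimitive, h]
  ring

/-- The integral is pinched between `X` and `X / sin² (y/2)` for an explicit `X`. -/
lemma integral_inv_sqrt_cos_bounds {y : ℝ} (h0 : 0 < y) (hy : y < π) :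
    Real.sqrt 2 * (2 * Real.log (1 + Real.sin (y / 2)) - Real.log (Real.cos (y / 2))) ≤
      (∫ t in (0 : ℝ)..y, 1 / Real.sqrt (Real.cos t - Real.cos y)) ∧
    (1 - Real.cos (y / 2) ^ 2) * (∫ t in (0 : ℝ)..y, 1 / Real.sqrt (Real.cos t - Real.cos y)) ≤
      Real.sqrt 2 * (2 * Real.log (1 + Real.sin (y / 2)) - Real.log (Real.cos (y / 2))) := by
  have hc := cos_half_pos h0.le hy
  have hc1 : 0 < 1 - Real.cos (y / 2) ^ 2 := by
    have := cos_half_lt_cos_half hy le_rfl h0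
    simp at this
    nlinarith
  have hderiv : ∀ t ∈ Set.Ioo 0 y,
      HasDerivAt (invSqrtCosPrimitive y) (invSqrtCosComparison y t) t :=
    fun t ht => hasDerivAt_invSqrtCosPrimitive hy ht.1.le ht.2
  have hint : IntervalIntegrable (invSqrtCosComparison y) MeasureTheory.volume 0 y :=
    (intervalIntegrable_iff_integrableOn_Ioc_of_le h0.le).2 <|
      intervalIntegral.integrableOn_deriv_of_nonneg (continuousOn_invSqrtCosPrimitive hy) hderiv
        fun t ht => invSqrtCosComparison_nonneg hy ht.1.le ht.2
  have hI := intervalIntegral.integral_eq_sub_of_hasDerivAt_of_le h0.le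
    (continuousOn_invSqrtCosPrimitive hy) hderiv hint
  rw [invSqrtCosPrimitive_sub h0.le hy] at hI
  have hg : IntervalIntegrable (fun t => 1 / Real.sqrt (Real.cos t - Real.cos y))
      MeasureTheory.volume 0 y := by
    rw [intervalIntegrable_iff_integrableOn_Ioo_of_le h0.le] at hint ⊢
    refine (hint.const_mul (1 - Real.cos (y / 2) ^ 2)⁻¹).mono'
      (by measurability) ?_
    refine (MeasureTheory.ae_restrict_mem measurableSet_Ioo).mono fun t ht => ?_
    rw [Real.norm_of_nonneg (by positivity), le_inv_mul_iff₀ hc1]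
    exact (invSqrtCosComparison_bounds hy ht.1.le ht.2).2
  rw [← hI, ← intervalIntegral.integral_const_mul]
  exact ⟨intervalIntegral.integral_mono_on_of_le_Ioo h0.le hint hg
      fun t ht => (invSqrtCosComparison_bounds hy ht.1.le ht.2).1,
    intervalIntegral.integral_mono_on_of_le_Ioo h0.le (hg.const_mul _) hint
      fun t ht => (invSqrtCosComparison_bounds hy ht.1.le ht.2).2⟩

/-- Elementary estimate for the explicit bound, in the variable `e = (π - y) / 2`. -/
lemma abs_two_log_one_add_cos_sub_log_sin_sub_le {e : ℝ} (h0 : 0 < e) (h1 : e < 1 / 2) :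
    |2 * Real.log (1 + Real.cos e) - Real.log (Real.sin e) - Real.log (4 / e)| ≤ e := by
  have hcos := Real.one_sub_sq_div_two_le_cos (x := e)
  have hcos1 := Real.cos_le_one e
  have hsin := Real.sin_gt_sub_cube h0
  have hsin1 := Real.sin_lt h0
  have he2 : e ^ 2 < 1 / 4 := by nlinarith
  have hq : 0 < 1 - e ^ 2 / 4 := by linarith
  have hsinq : e * (1 - e ^ 2 / 4) < Real.sin e := by nlinarith [pow_pos h0 3]
  have hs0 : 0 < Real.sin e := by nlinarith [mul_pos h0 hq]
  have l4 : Real.log 4 = 2 * Real.log 2 := by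
    rw [show (4 : ℝ) = 2 ^ 2 by norm_num, Real.log_pow]; norm_num
  have hlogq : -(e / 2) ≤ Real.log (1 - e ^ 2 / 4) := by
    refine le_trans ?_ (Real.one_sub_inv_le_log_of_pos hq)
    have : (1 - e ^ 2 / 4)⁻¹ ≤ 1 + e / 2 := by
      rw [inv_le_iff_one_le_mul₀ hq]
      nlinarith
    linarith
  have u1 : Real.log (1 + Real.cos e) ≤ Real.log 2 :=
    Real.log_le_log (by linarith) (by linarith)
  have u2 : Real.log 2 + Real.log (1 - e ^ 2 / 4) ≤ Real.log (1 + Real.cos e) := by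
    rw [← Real.log_mul two_ne_zero hq.ne']
    exact Real.log_le_log (by linarith) (by linarith)
  have v1 : Real.log (Real.sin e) ≤ Real.log e := Real.log_le_log hs0 hsin1.le
  have v2 : Real.log e + Real.log (1 - e ^ 2 / 4) ≤ Real.log (Real.sin e) := by
    rw [← Real.log_mul h0.ne' hq.ne']
    exact Real.log_le_log (by positivity) hsinq.le
  rw [Real.log_div (by norm_num) h0.ne', l4, abs_le]
  constructor <;> linarith

/-- As `y → π⁻`, `∫_0^y dt/√(cos t − cos y) = √2 log(8/(π − y)) + O(π − y)`. -/
theorem integral_inv_sqrt_cos_log_asymptotics :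
    (fun y : ℝ =>
        (∫ t in (0 : ℝ)..y, 1 / Real.sqrt (Real.cos t - Real.cos y)) -
          Real.sqrt 2 * Real.log (8 / (π - y)))
      =O[𝓝[<] π] fun y : ℝ => π - y := by
  refine Asymptotics.IsBigO.of_bound 10 ?_
  filter_upwards [Ioo_mem_nhdsLT (show π - 1 < π by linarith)] with y hy
  obtain ⟨hy1, hy⟩ := hy
  have h0 : 0 < y := by linarith [Real.pi_gt_three]
  obtain ⟨hl, hu⟩ := integral_inv_sqrt_cos_bounds h0 hy
  set I := ∫ t in (0 : ℝ)..y, 1 / Real.sqrt (Real.cos t - Real.cos y)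
  obtain ⟨e, rfl⟩ : ∃ e, y = π - 2 * e := ⟨(π - y) / 2, by ring⟩
  have he0 : 0 < e := by linarith
  have he1 : e < 1 / 2 := by linarith
  rw [show (π - 2 * e) / 2 = π / 2 - e by ring, Real.sin_pi_div_two_sub,
    Real.cos_pi_div_two_sub] at hl hu
  have hD := abs_two_log_one_add_cos_sub_log_sin_sub_le he0 he1
  rw [show π - (π - 2 * e) = 2 * e by ring, show 8 / (2 * e) = 4 / e by field_simp; norm_num,
    Real.norm_eq_abs, Real.norm_of_nonneg (by positivity)]
  have hs0 : 0 < Real.sin e :=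
    Real.sin_pos_of_pos_of_lt_pi he0 (by linarith [Real.pi_gt_three])
  have hs1 := Real.sin_lt he0
  have hsq : Real.sqrt 2 ≤ 3 / 2 := Real.sqrt_le_iff.2 ⟨by norm_num, by norm_num⟩
  have hsq0 : 0 ≤ Real.sqrt 2 := Real.sqrt_nonneg 2
  have hX : 2 * Real.log (1 + Real.cos e) - Real.log (Real.sin e) ≤ 4 / Real.sin e := by
    have hcos : 0 < Real.cos e := Real.cos_pos_of_mem_Ioo
      ⟨by linarith [Real.pi_gt_three], by linarith [Real.pi_gt_three]⟩
    have h1 : Real.log (1 + Real.cos e) ≤ Real.log 2 :=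
      Real.log_le_log (by linarith) (by linarith [Real.cos_le_one e])
    have h2 := Real.log_le_self (x := 4 / Real.sin e) (by positivity)
    rw [Real.log_div (by norm_num) hs0.ne', show (4 : ℝ) = 2 ^ 2 by norm_num,
      Real.log_pow] at h2
    push_cast at h2
    norm_num at h2 ⊢
    linarith
  set X := 2 * Real.log (1 + Real.cos e) - Real.log (Real.sin e)
  have hsX : Real.sqrt 2 * X * Real.sin e ≤ 6 := by
    rw [le_div_iff₀ hs0] at hX
    nlinarith
  have hIs : I * Real.sin e ≤ 8 := by nlinarith
  have hIX : I - Real.sqrt 2 * X ≤ 8 * e := by nlinarith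
  rw [abs_le] at hD ⊢
  constructor <;> nlinarith
end

section
/- Let y₀ > 0 be the unique positive solution of y·tanh(y) = 1 and set τ₀ = y₀/cosh(y₀) (numerically τ₀ ≈ 0.662743). For real τ ∈ (0, τ₀) let λ(τ) ∈ (0, π/2) be the unique solution of λ/cos λ = τ, and define Σ̂²(τ) = sin(2λ(τ))/λ(τ) − (1 + cos(2λ(τ)))/2, with Σ̂²(0) = 1. Then there exists a function F holomorphic on the open disc {z ∈ ℂ : |z| < τ₀} with F(τ) = Σ̂²(τ) for all real τ ∈ [0, τ₀), and the radius of convergence of the Taylor series of F at 0 is exactly τ₀. -/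
open scoped Real

open Filter Topology Metric

theorem Complex.norm_sin_le_sinh_norm (z : ℂ) : ‖Complex.sin z‖ ≤ Real.sinh ‖z‖ :=
  (Complex.hasSum_sin z).norm_le_of_bounded (Real.hasSum_sinh ‖z‖) fun n ↦ by simp

theorem Complex.norm_cos_le_cosh_norm (z : ℂ) : ‖Complex.cos z‖ ≤ Real.cosh ‖z‖ :=
  (Complex.hasSum_cos z).norm_le_of_bounded (Real.hasSum_cosh ‖z‖) fun n ↦ by simp

theorem Complex.norm_cos_sub_cos_le {r : ℝ} {v w : ℂ} (hv : ‖v‖ ≤ r) (hw : ‖w‖ ≤ r) :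
    ‖Complex.cos v - Complex.cos w‖ ≤ Real.sinh r * ‖v - w‖ := by
  refine (convex_closedBall (0 : ℂ) r).norm_image_sub_le_of_norm_deriv_le (𝕜 := ℂ)
    (fun x _ ↦ Complex.differentiable_cos x) (fun x hx ↦ ?_)
    (mem_closedBall_zero_iff.2 hw) (mem_closedBall_zero_iff.2 hv)
  rw [Complex.deriv_cos, norm_neg]
  exact (Complex.norm_sin_le_sinh_norm x).trans
    (Real.sinh_le_sinh.2 (mem_closedBall_zero_iff.1 hx))

theorem Complex.norm_mul_cos_sub_le {r : ℝ} {z v w : ℂ} (hv : ‖v‖ ≤ r) (hw : ‖w‖ ≤ r) :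
    ‖z * Complex.cos v - z * Complex.cos w‖ ≤ ‖z‖ * Real.sinh r * ‖v - w‖ := by
  rw [← mul_sub, norm_mul, mul_assoc]
  gcongr
  exact Complex.norm_cos_sub_cos_le hv hw

/-- Solutions of `w = z * cos w` in a disc on which `w ↦ z * cos w` contracts are unique. -/
theorem Complex.eq_of_eq_mul_cos {r : ℝ} {z v w : ℂ} (hz : ‖z‖ * Real.sinh r < 1)
    (hv : ‖v‖ ≤ r) (hw : ‖w‖ ≤ r) (hv' : v = z * Complex.cos v) (hw' : w = z * Complex.cos w) :
    v = w := by
  have h := Complex.norm_mul_cos_sub_le (z := z) hv hw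
  rw [← hv', ← hw'] at h
  rw [← sub_eq_zero, ← norm_le_zero_iff]
  nlinarith [norm_nonneg (v - w)]

/-- The fixed point iterates of `w ↦ z * cos w` starting from `0`. -/
noncomputable def mulCosIterate : ℕ → ℂ → ℂ
  | 0, _ => 0
  | n + 1, z => z * Complex.cos (mulCosIterate n z)

theorem differentiable_mulCosIterate (n : ℕ) : Differentiable ℂ (mulCosIterate n) := by
  induction n with
  | zero => exact differentiable_const 0
  | succ n ih => exact differentiable_id.mul ih.ccos

theorem norm_mulCosIterate_le {r : ℝ} (hr : 0 ≤ r) {z : ℂ} (hz : ‖z‖ * Real.cosh r ≤ r) (n : ℕ) :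
    ‖mulCosIterate n z‖ ≤ r := by
  induction n with
  | zero => simpa [mulCosIterate] using hr
  | succ n ih =>
    rw [mulCosIterate, norm_mul]
    refine le_trans ?_ hz
    gcongr
    refine (Complex.norm_cos_le_cosh_norm _).trans (Real.cosh_le_cosh.2 ?_)
    rwa [abs_norm, abs_of_nonneg hr]

theorem exists_eq_mul_cos {r : ℝ} (hr : 0 ≤ r) {z : ℂ} (hz : ‖z‖ * Real.cosh r ≤ r)
    (hz' : ‖z‖ * Real.sinh r < 1) : ∃ w : ℂ, ‖w‖ ≤ r ∧ w = z * Complex.cos w := by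
  have hb := norm_mulCosIterate_le hr hz
  have hstep : ∀ n, dist (mulCosIterate n z) (mulCosIterate (n + 1) z) ≤
      r * (‖z‖ * Real.sinh r) ^ n := by
    intro n
    rw [dist_comm, dist_eq_norm]
    induction n with
    | zero => simpa [mulCosIterate] using hb 1
    | succ n ih =>
      refine (Complex.norm_mul_cos_sub_le (hb (n + 1)) (hb n)).trans ?_
      have : 0 ≤ ‖z‖ * Real.sinh r := mul_nonneg (norm_nonneg _) (Real.sinh_nonneg_iff.2 hr)
      calc _ ≤ ‖z‖ * Real.sinh r * (r * (‖z‖ * Real.sinh r) ^ n) := by gcongr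
        _ = _ := by ring
  obtain ⟨w, hw⟩ := cauchySeq_tendsto_of_complete (cauchySeq_of_le_geometric _ _ hz' hstep)
  refine ⟨w, le_of_tendsto' hw.norm hb, tendsto_nhds_unique ((tendsto_add_atTop_iff_nat 1).2 hw) ?_⟩
  exact ((Complex.continuous_cos.tendsto w).comp hw).const_mul z

theorem norm_mulCosIterate_sub_le {r ρ : ℝ} (hr : 0 ≤ r) {z w : ℂ} (hz : ‖z‖ * Real.cosh r ≤ r)
    (hzρ : ‖z‖ ≤ ρ) (hw : ‖w‖ ≤ r) (hw' : w = z * Complex.cos w) (n : ℕ) :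
    ‖w - mulCosIterate n z‖ ≤ (ρ * Real.sinh r) ^ n * r := by
  have hs : 0 ≤ Real.sinh r := Real.sinh_nonneg_iff.2 hr
  have hρ : 0 ≤ ρ := (norm_nonneg z).trans hzρ
  induction n with
  | zero => simpa [mulCosIterate] using hw
  | succ n ih =>
    calc ‖w - mulCosIterate (n + 1) z‖
        = ‖z * Complex.cos w - z * Complex.cos (mulCosIterate n z)‖ := by
          rw [← hw', mulCosIterate]
      _ ≤ ‖z‖ * Real.sinh r * ‖w - mulCosIterate n z‖ :=
          Complex.norm_mul_cos_sub_le hw (norm_mulCosIterate_le hr hz n)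
      _ ≤ ρ * Real.sinh r * ((ρ * Real.sinh r) ^ n * r) := by gcongr
      _ = _ := by ring

/-- The equation `w = z * cos w` has a solution depending holomorphically on `z` in every disc
on which `w ↦ z * cos w` contracts a fixed disc. -/
theorem exists_differentiableOn_eq_mul_cos {r R : ℝ} (hr : 0 < r) (hc : R * Real.cosh r ≤ r)
    (hs : R * Real.sinh r ≤ 1) :
    ∃ L : ℂ → ℂ, DifferentiableOn ℂ L (ball 0 R) ∧
      ∀ z ∈ ball (0 : ℂ) R, ‖L z‖ ≤ r ∧ L z = z * Complex.cos (L z) := by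
  have hcosh : ∀ z ∈ ball (0 : ℂ) R, ‖z‖ * Real.cosh r ≤ r := fun z hz ↦
    (mul_le_mul_of_nonneg_right (mem_ball_zero_iff.1 hz).le (Real.cosh_pos r).le).trans hc
  have hsinh : ∀ ρ < R, ρ * Real.sinh r < 1 := fun ρ hρ ↦
    (mul_lt_mul_of_pos_right hρ (Real.sinh_pos_iff.2 hr)).trans_le hs
  have hex : ∀ z : ℂ, ∃ w : ℂ, z ∈ ball (0 : ℂ) R → ‖w‖ ≤ r ∧ w = z * Complex.cos w := by
    intro z
    by_cases hz : z ∈ ball (0 : ℂ) R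
    · obtain ⟨w, hw⟩ := exists_eq_mul_cos hr.le (hcosh z hz) (hsinh _ (mem_ball_zero_iff.1 hz))
      exact ⟨w, fun _ ↦ hw⟩
    · exact ⟨0, fun h ↦ absurd h hz⟩
  choose L hL using hex
  refine ⟨L, ?_, hL⟩
  refine TendstoLocallyUniformlyOn.differentiableOn (φ := atTop) (F := mulCosIterate) ?_
    (.of_forall fun n ↦ (differentiable_mulCosIterate n).differentiableOn) isOpen_ball
  rw [Metric.tendstoLocallyUniformlyOn_iff]
  intro ε hε z hz
  obtain ⟨ρ, hzρ, hρR⟩ := exists_between (mem_ball_zero_iff.1 hz)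
  refine ⟨ball 0 ρ, mem_nhdsWithin_of_mem_nhds (isOpen_ball.mem_nhds (mem_ball_zero_iff.2 hzρ)), ?_⟩
  have hlim : Tendsto (fun n : ℕ ↦ (ρ * Real.sinh r) ^ n * r) atTop (𝓝 0) := by
    simpa using (tendsto_pow_atTop_nhds_zero_of_lt_one
      (mul_nonneg ((norm_nonneg z).trans hzρ.le) (Real.sinh_nonneg_iff.2 hr.le))
      (hsinh ρ hρR)).mul_const r
  filter_upwards [hlim.eventually (gt_mem_nhds hε)] with n hn x hx
  have hxR : x ∈ ball (0 : ℂ) R := ball_subset_ball hρR.le hx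
  rw [dist_eq_norm]
  exact (norm_mulCosIterate_sub_le hr.le (hcosh x hxR) (mem_ball_zero_iff.1 hx).le
    (hL x hxR).1 (hL x hxR).2 n).trans_lt hn

theorem HasFPowerSeriesAt.ofReal_le_radius_of_differentiableOn {F : ℂ → ℂ} {c : ℂ} {R : ℝ}
    {p : FormalMultilinearSeries ℂ ℂ ℂ} (hp : HasFPowerSeriesAt F p c)
    (hF : DifferentiableOn ℂ F (ball c R)) : ENNReal.ofReal R ≤ p.radius := by
  refine ENNReal.le_of_forall_nnreal_lt fun r hr ↦ ?_
  rcases eq_zero_or_pos r with rfl | hr0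
  · simp
  have hrR : (r : ℝ) < R := by
    simpa using (ENNReal.lt_ofReal_iff_toReal_lt ENNReal.coe_ne_top).1 hr
  have h := (hF.mono (closedBall_subset_ball hrR)).hasFPowerSeriesOnBall hr0
  rw [hp.eq_formalMultilinearSeries h.hasFPowerSeriesAt]
  exact h.r_le

/-- The entire function `w ↦ sin (2 * w) / w - (1 + cos (2 * w)) / 2`, with its removable
singularity at `0` filled in. -/
noncomputable def impliedVarianceProfile (w : ℂ) : ℂ :=
  2 * dslope Complex.sin 0 w * Complex.cos w - Complex.cos w ^ 2

theorem impliedVarianceProfile_zero : impliedVarianceProfile 0 = 1 := by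
  simp [impliedVarianceProfile]
  norm_num

theorem impliedVarianceProfile_of_ne {w : ℂ} (hw : w ≠ 0) :
    impliedVarianceProfile w =
      Complex.sin (2 * w) / w - (1 + Complex.cos (2 * w)) / 2 := by
  rw [impliedVarianceProfile, dslope_of_ne _ hw, slope_def_field, Complex.sin_two_mul,
    Complex.cos_two_mul]
  simp only [Complex.sin_zero, sub_zero]
  ring

theorem differentiable_impliedVarianceProfile : Differentiable ℂ impliedVarianceProfile := by
  have h : Differentiable ℂ (dslope Complex.sin 0) := by
    rw [← differentiableOn_univ, Complex.differentiableOn_dslope univ_mem]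
    exact Complex.differentiable_sin.differentiableOn
  unfold impliedVarianceProfile
  fun_prop

theorem lt_norm_impliedVarianceProfile_mul_I {C y : ℝ} (hy : 4 ≤ y) (hC : C ≤ y) :
    C < ‖impliedVarianceProfile (y * Complex.I)‖ := by
  have hy0 : 0 < y := by linarith
  have hyI : (y : ℂ) * Complex.I ≠ 0 := by simp [hy0.ne']
  have hval : impliedVarianceProfile (y * Complex.I) =
      ((2 * Real.sinh y * Real.cosh y / y - Real.cosh y ^ 2 : ℝ) : ℂ) := by
    rw [impliedVarianceProfile, dslope_of_ne _ hyI, slope_def_field]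
    simp only [Complex.sin_zero, sub_zero, Complex.sin_mul_I, Complex.cos_mul_I]
    rw [mul_div_mul_right _ _ Complex.I_ne_zero]
    push_cast
    ring
  have hsinh : y ≤ Real.sinh y := Real.self_le_sinh_iff.2 hy0.le
  have hlt : Real.sinh y < Real.cosh y := Real.sinh_lt_cosh y
  have hquot : 2 * Real.sinh y * Real.cosh y / y ≤ Real.cosh y ^ 2 / 2 := by
    rw [div_le_iff₀ hy0]
    nlinarith [mul_pos (Real.cosh_pos y) (Real.cosh_pos y),
      mul_lt_mul_of_pos_right hlt (Real.cosh_pos y)]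
  rw [hval, Complex.norm_real, Real.norm_eq_abs, abs_sub_comm]
  refine lt_of_lt_of_le ?_ (le_abs_self _)
  nlinarith

/-- If `y₀ * tanh y₀ = 1`, the tangent to `cosh` at `y₀` passes through the origin, so that
`y / cosh y` is maximal at `y₀`. -/
theorem mul_cosh_le_mul_cosh {y₀ : ℝ} (h : y₀ * Real.sinh y₀ = Real.cosh y₀) (hy₀ : 0 < y₀)
    (y : ℝ) : y * Real.cosh y₀ ≤ y₀ * Real.cosh y := by
  have h1 : 1 < y₀ := by
    have := Real.sinh_lt_cosh y₀
    have := Real.sinh_pos_iff.2 hy₀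
    by_contra! hle
    nlinarith
  have key : y ≤ y₀ * Real.cosh (y - y₀) + Real.sinh (y - y₀) := by
    have hc := Real.one_le_cosh (y - y₀)
    have he := Real.add_one_le_exp (y - y₀)
    rw [← Real.cosh_add_sinh] at he
    nlinarith
  calc y * Real.cosh y₀
      ≤ (y₀ * Real.cosh (y - y₀) + Real.sinh (y - y₀)) * Real.cosh y₀ :=
        mul_le_mul_of_nonneg_right key (Real.cosh_pos y₀).le
    _ = y₀ * Real.cosh (y - y₀ + y₀) := by
        rw [Real.cosh_add]
        linear_combination -Real.sinh (y - y₀) * h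
    _ = y₀ * Real.cosh y := by rw [sub_add_cancel]

theorem abs_div_cosh_le {y₀ : ℝ} (h : y₀ * Real.sinh y₀ = Real.cosh y₀) (hy₀ : 0 < y₀) (y : ℝ) :
    |y / Real.cosh y| ≤ y₀ / Real.cosh y₀ := by
  rw [abs_div, abs_of_pos (Real.cosh_pos y), div_le_div_iff₀ (Real.cosh_pos y) (Real.cosh_pos y₀)]
  simpa using mul_cosh_le_mul_cosh h hy₀ |y|

/-- A power series `p` with `p (y * I / cosh y) = impliedVarianceProfile (y * I)` for small real `y`
has radius of convergence at most any bound for `|y / cosh y|`: otherwise the identity would hold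
for all real `y`, with a bounded left side and an unbounded right side. -/
theorem FormalMultilinearSeries.radius_le_of_sum_eq_impliedVarianceProfile
    {p : FormalMultilinearSeries ℂ ℂ ℂ} {R : ℝ} (hR : ∀ y : ℝ, |y / Real.cosh y| ≤ R)
    (hp : ∀ᶠ y : ℝ in 𝓝 0, p.sum (((y / Real.cosh y : ℝ) : ℂ) * Complex.I) =
      impliedVarianceProfile (y * Complex.I)) :
    p.radius ≤ ENNReal.ofReal R := by
  by_contra! hlt
  have hsum := p.hasFPowerSeriesOnBall (pos_of_gt hlt)
  have hball : closedBall (0 : ℂ) R ⊆ eball 0 p.radius := fun z hz ↦ by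
    rw [mem_eball_zero_iff]
    refine lt_of_le_of_lt ?_ hlt
    rw [← ofReal_norm]
    exact ENNReal.ofReal_le_ofReal (mem_closedBall_zero_iff.1 hz)
  have hmem : ∀ y : ℝ, ((y / Real.cosh y : ℝ) : ℂ) * Complex.I ∈ closedBall (0 : ℂ) R := fun y ↦ by
    rw [mem_closedBall_zero_iff, norm_mul, Complex.norm_I, mul_one, Complex.norm_real]
    exact hR y
  have hofReal : ∀ x : ℝ, AnalyticAt ℝ (fun x : ℝ ↦ (x : ℂ)) x :=
    fun x ↦ Complex.ofRealCLM.analyticAt x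
  have hleft : AnalyticOnNhd ℝ
      (fun y : ℝ ↦ p.sum (((y / Real.cosh y : ℝ) : ℂ) * Complex.I)) Set.univ := fun y _ ↦ by
    have hdiv : AnalyticAt ℝ (fun y : ℝ ↦ y / Real.cosh y) y :=
      analyticAt_id.div Real.analyticAt_cosh (Real.cosh_pos y).ne'
    have hinner : AnalyticAt ℝ (fun y : ℝ ↦ ((y / Real.cosh y : ℝ) : ℂ) * Complex.I) y :=
      ((hofReal _).fun_comp hdiv).mul analyticAt_const
    exact AnalyticAt.fun_comp (g := p.sum)
      (hsum.analyticAt_of_mem (hball (hmem y))).restrictScalars hinner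
  have hright : AnalyticOnNhd ℝ
      (fun y : ℝ ↦ impliedVarianceProfile (y * Complex.I)) Set.univ := fun y _ ↦
    (differentiable_impliedVarianceProfile.analyticAt _).restrictScalars.fun_comp
      ((hofReal y).mul analyticAt_const)
  have heq := hleft.eq_of_eventuallyEq hright hp
  obtain ⟨C, hC⟩ := (isCompact_closedBall (0 : ℂ) R).exists_bound_of_continuousOn
    (hsum.continuousOn.mono hball)
  have hlarge := lt_norm_impliedVarianceProfile_mul_I (le_max_left 4 C) (le_max_right 4 C)
  have hbound := hC _ (hmem (max 4 C))
  rw [congrFun heq (max 4 C)] at hbound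
  exact absurd hbound (not_le.2 hlarge)

/-- Let `y₀ > 0` solve `y tanh y = 1` and set `τ₀ = y₀ / cosh y₀ ≈ 0.662743`. Let
`lam τ ∈ (0, π/2)` be the unique solution of `λ / cos λ = τ` for `τ ∈ (0, τ₀)`, and let
`Σ̂²(τ) = sin(2λ(τ))/λ(τ) − (1 + cos(2λ(τ)))/2` with `Σ̂²(0) = 1`. Then there exists a
function `F` holomorphic on the disc `|z| < τ₀` agreeing with `Σ̂²` on `[0, τ₀)`, whose
Taylor series at `0` has radius of convergence exactly `τ₀`. -/
theorem scaling_limit_implied_variance_radius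
    (y₀ : ℝ) (hy₀ : 0 < y₀) (hy₀eq : y₀ * Real.tanh y₀ = 1)
    (τ₀ : ℝ) (hτ₀ : τ₀ = y₀ / Real.cosh y₀)
    (lam : ℝ → ℝ)
    (hlam : ∀ τ ∈ Set.Ioo (0 : ℝ) τ₀,
      lam τ ∈ Set.Ioo 0 (π / 2) ∧ lam τ / Real.cos (lam τ) = τ)
    (Sig2 : ℝ → ℝ) (hSig2zero : Sig2 0 = 1)
    (hSig2 : ∀ τ ∈ Set.Ioo (0 : ℝ) τ₀,
      Sig2 τ = Real.sin (2 * lam τ) / lam τ - (1 + Real.cos (2 * lam τ)) / 2) :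
    ∃ (F : ℂ → ℂ) (p : FormalMultilinearSeries ℂ ℂ ℂ),
      DifferentiableOn ℂ F (Metric.ball (0 : ℂ) τ₀) ∧
      (∀ τ : ℝ, τ ∈ Set.Ico (0 : ℝ) τ₀ → F (τ : ℂ) = (Sig2 τ : ℂ)) ∧
      HasFPowerSeriesAt F p 0 ∧ p.radius = ENNReal.ofReal τ₀ := by
  have hcosh : 0 < Real.cosh y₀ := Real.cosh_pos y₀
  have hsinh : y₀ * Real.sinh y₀ = Real.cosh y₀ := by
    rw [Real.tanh_eq_sinh_div_cosh] at hy₀eq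
    field_simp at hy₀eq
    exact hy₀eq
  have hτ₀pos : 0 < τ₀ := hτ₀ ▸ div_pos hy₀ hcosh
  have hτ₀cosh : τ₀ * Real.cosh y₀ = y₀ := by rw [hτ₀, div_mul_cancel₀ _ hcosh.ne']
  have hτ₀sinh : τ₀ * Real.sinh y₀ = 1 := by
    rw [hτ₀, div_mul_eq_mul_div, hsinh, div_self hcosh.ne']
  obtain ⟨L, hLd, hL⟩ := exists_differentiableOn_eq_mul_cos hy₀ hτ₀cosh.le hτ₀sinh.le
  have huniq : ∀ z ∈ ball (0 : ℂ) τ₀, ∀ w : ℂ, ‖w‖ ≤ y₀ → w = z * Complex.cos w → L z = w :=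
    fun z hz w hw hw' ↦ Complex.eq_of_eq_mul_cos
      ((mul_lt_mul_of_pos_right (mem_ball_zero_iff.1 hz) (Real.sinh_pos_iff.2 hy₀)).trans_eq
        hτ₀sinh) (hL z hz).1 hw (hL z hz).2 hw'
  have hFd : DifferentiableOn ℂ (fun z ↦ impliedVarianceProfile (L z)) (ball 0 τ₀) :=
    differentiable_impliedVarianceProfile.comp_differentiableOn hLd
  obtain ⟨p, hp⟩ := hFd.analyticAt (ball_mem_nhds 0 hτ₀pos)
  refine ⟨_, p, hFd, fun τ hτ ↦ ?_, hp,
    le_antisymm ?_ (hp.ofReal_le_radius_of_differentiableOn hFd)⟩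
  · have hmem : (τ : ℂ) ∈ ball (0 : ℂ) τ₀ := by
      rw [mem_ball_zero_iff, Complex.norm_real, Real.norm_of_nonneg hτ.1]
      exact hτ.2
    rcases hτ.1.eq_or_lt with rfl | hpos
    · have h0 : L ((0 : ℝ) : ℂ) = 0 := huniq _ hmem 0 (by simpa using hy₀.le) (by simp)
      simp only [h0, impliedVarianceProfile_zero, hSig2zero, Complex.ofReal_one]
    · obtain ⟨⟨hl0, hl1⟩, hleq⟩ := hlam τ ⟨hpos, hτ.2⟩
      have hcos : 0 < Real.cos (lam τ) :=
        Real.cos_pos_of_mem_Ioo ⟨by linarith [Real.pi_pos], hl1⟩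
      have hfix : lam τ = τ * Real.cos (lam τ) := (div_eq_iff hcos.ne').1 hleq
      have hle : lam τ ≤ y₀ := by
        nlinarith [Real.cos_le_one (lam τ), Real.one_le_cosh y₀, hτ.2]
      have hLτ : L τ = lam τ := by
        refine huniq _ hmem _ ?_ (by exact_mod_cast hfix)
        rwa [Complex.norm_real, Real.norm_of_nonneg hl0.le]
      simp only [hLτ]
      rw [impliedVarianceProfile_of_ne (by exact_mod_cast hl0.ne'), hSig2 τ ⟨hpos, hτ.2⟩]
      push_cast
      rfl
  · refine FormalMultilinearSeries.radius_le_of_sum_eq_impliedVarianceProfile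
      (fun y ↦ hτ₀ ▸ abs_div_cosh_le hsinh hy₀ y) ?_
    obtain ⟨r, hr⟩ := hp
    have hcont : Continuous fun y : ℝ ↦ ((y / Real.cosh y : ℝ) : ℂ) * Complex.I := by
      have hdiv : Continuous fun y : ℝ ↦ y / Real.cosh y :=
        continuous_id.div Real.continuous_cosh fun y ↦ (Real.cosh_pos y).ne'
      fun_prop
    have hlim : Tendsto (fun y : ℝ ↦ ((y / Real.cosh y : ℝ) : ℂ) * Complex.I) (𝓝 0) (𝓝 0) := by
      simpa using hcont.tendsto 0
    filter_upwards [hlim.eventually (ball_mem_nhds 0 hτ₀pos),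
      hlim.eventually (eball_mem_nhds 0 hr.r_pos),
      closedBall_mem_nhds (0 : ℝ) hy₀] with y hyτ hyr hy
    have hLy : L (((y / Real.cosh y : ℝ) : ℂ) * Complex.I) = y * Complex.I := by
      refine huniq _ hyτ _ ?_ ?_
      · simpa using hy
      · have : Complex.cosh y ≠ 0 := by exact_mod_cast (Real.cosh_pos y).ne'
        rw [Complex.cos_mul_I]
        push_cast
        field_simp
    have := hr.sum hyr
    rw [zero_add] at this
    rw [← this, hLy]
end

section
/- Fix τ > 0. Let λ = λ(τ) ∈ (0, π/2) be the unique solution of λ/cos λ = τ and set Σ̂²(τ) = sin(2λ)/λ − (1 + cos(2λ))/2. Define, for σ₀ > 0 and T > 0, the normalized at-the-money SABR value V(T, σ₀) = (2·e^{−T/8}/(π^{3/2}·√T)) · ∫_0^∞ e^{−u²/(2T)} g(u; σ₀) du. Then lim_{σ₀→∞} (1/σ₀) · log(1 − V(2τ/σ₀, σ₀)) = −(τ/4)·Σ̂²(τ). -/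
open scoped Real

/-- The normalized at-the-money SABR option time value
`V(T, σ₀) = (2 e^(−T/8)/(π^(3/2) √T)) ∫_0^∞ e^(−u²/(2T)) g(u; σ₀) du`. -/
noncomputable def sabrValue (T σ₀ : ℝ) : ℝ :=
  2 * Real.exp (-T / 8) / (π ^ (3 / 2 : ℝ) * Real.sqrt T) *
    ∫ u in Set.Ioi (0 : ℝ), Real.exp (-u ^ 2 / (2 * T)) * sabrPayoff σ₀ u

open MeasureTheory Set Filter Topology

lemma integrableOn_Ioi_of_norm_le_exp {E : Type*} [NormedAddCommGroup E] {f : ℝ → E} {C c : ℝ}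
    (hc : 0 < c) (hm : AEStronglyMeasurable f (volume.restrict (Ioi 0)))
    (hb : ∀ x, 0 < x → ‖f x‖ ≤ C * Real.exp (-c * x)) : IntegrableOn f (Ioi 0) := by
  refine Integrable.mono' ((integrableOn_exp_mul_Ioi (neg_lt_zero.2 hc) 0).const_mul C) hm ?_
  exact (ae_restrict_iff' measurableSet_Ioi).2 (.of_forall fun x hx => hb x hx)

/-- The Cauchy integral theorem on the half-strip `{0 ≤ re z, 0 ≤ im z ≤ h}`. -/
lemma integral_halfStrip_eq {f : ℂ → ℂ} {h C : ℝ} (hh : 0 ≤ h)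
    (hc : ContinuousOn f {z | 0 ≤ z.re ∧ z.im ∈ Icc 0 h})
    (hd : ∀ z : ℂ, 0 < z.re → 0 < z.im → z.im < h → DifferentiableAt ℂ f z)
    (hb : ∀ z : ℂ, 0 ≤ z.re → z.im ∈ Icc 0 h → ‖f z‖ ≤ C * Real.exp (-z.re)) :
    ∫ x in Ioi (0 : ℝ), f x =
      (∫ x in Ioi (0 : ℝ), f (x + h * Complex.I)) +
        Complex.I * ∫ y in (0 : ℝ)..h, f (y * Complex.I) := by
  have key : ∀ y ∈ Icc 0 h, IntegrableOn (fun x : ℝ => f (x + y * Complex.I)) (Ioi 0) := by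
    intro y hy
    refine integrableOn_Ioi_of_norm_le_exp (C := C) one_pos
      (ContinuousOn.aestronglyMeasurable (hc.comp (by fun_prop) ?_) measurableSet_Ioi) ?_
    · intro x hx
      simpa using ⟨le_of_lt hx, hy⟩
    · intro x hx
      simpa using hb (x + y * Complex.I) (by simpa using hx.le) (by simpa using hy)
  have h0 := key 0 (by simp [hh])
  have h1 := key h (by simp [hh])
  simp only [Complex.ofReal_zero, zero_mul, add_zero] at h0
  have t0 := intervalIntegral_tendsto_integral_Ioi 0 h0 tendsto_id
  have t1 := intervalIntegral_tendsto_integral_Ioi 0 h1 tendsto_id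
  have t2 : Tendsto (fun R : ℝ => ∫ y in (0 : ℝ)..h, f (R + y * Complex.I)) atTop (𝓝 0) := by
    have : Tendsto (fun R : ℝ => C * Real.exp (-R) * |h - 0|) atTop (𝓝 0) := by
      have := (Real.tendsto_exp_neg_atTop_nhds_zero.const_mul C).mul_const |h - 0|
      simpa using this
    refine squeeze_zero_norm' ?_ this
    filter_upwards [eventually_ge_atTop 0] with R hR
    refine intervalIntegral.norm_integral_le_of_norm_le_const fun y hy => ?_
    rw [uIoc_of_le hh] at hy
    simpa using hb (R + y * Complex.I) (by simpa using hR) (by simpa using ⟨hy.1.le, hy.2⟩)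
  have heq : ∀ᶠ R : ℝ in atTop, (∫ x in (0 : ℝ)..R, f x) =
      (∫ x in (0 : ℝ)..R, f (x + h * Complex.I)) -
        Complex.I * (∫ y in (0 : ℝ)..h, f (R + y * Complex.I)) +
        Complex.I * ∫ y in (0 : ℝ)..h, f (y * Complex.I) := by
    filter_upwards [eventually_ge_atTop 0] with R hR
    have := Complex.integral_boundary_rect_eq_zero_of_continuousOn_of_differentiableOn f 0
      (R + h * Complex.I) (hc.mono ?_) ?_
    · simp only [Complex.zero_re, Complex.zero_im, Complex.add_re, Complex.ofReal_re,
        Complex.mul_re, Complex.I_re, mul_zero, Complex.ofReal_im, Complex.I_im, mul_one, sub_self,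
        add_zero, Complex.add_im, Complex.mul_im, zero_add, Complex.ofReal_zero, zero_mul,
        smul_eq_mul] at this
      linear_combination this
    · intro z hz
      simp only [Complex.zero_re, Complex.add_re, Complex.ofReal_re, Complex.mul_re, Complex.I_re,
        mul_zero, Complex.ofReal_im, Complex.I_im, mul_one, sub_self, add_zero, Complex.zero_im,
        Complex.add_im, Complex.mul_im, zero_add, Complex.mem_reProdIm, uIcc_of_le hR,
        uIcc_of_le hh] at hz
      exact ⟨hz.1.1, hz.2⟩
    · intro z hz
      simp [Complex.mem_reProdIm, hR, hh] at hz
      exact (hd z hz.1.1 hz.2.1 hz.2.2).differentiableWithinAt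
  have t3 := (t1.sub (t2.const_mul Complex.I)).add_const
    (Complex.I * ∫ y in (0 : ℝ)..h, f (y * Complex.I))
  have := tendsto_nhds_unique (t0.congr' heq) t3
  simpa using this

namespace Complex

lemma norm_sqrt_eq (z : ℂ) : ‖z.sqrt‖ = √‖z‖ := by
  have h := norm_cpow_real z 2⁻¹
  rw [Complex.sqrt, Real.sqrt_eq_rpow, one_div, ← h]
  norm_num

lemma measurable_sqrt : Measurable Complex.sqrt := by
  unfold Complex.sqrt
  fun_prop

lemma continuousAt_sqrt_of_re_nonneg {z : ℂ} (hz : 0 ≤ z.re) : ContinuousAt Complex.sqrt z :=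
  continuousAt_cpow_const_of_re_pos (Or.inl hz) (by norm_num)

lemma sqrt_ofReal_of_nonneg {x : ℝ} (hx : 0 ≤ x) : (x : ℂ).sqrt = (√x : ℝ) := by
  rw [sqrt_of_nonneg (by exact_mod_cast hx), ofReal_re]

lemma cosh_re (z : ℂ) : (cosh z).re = Real.cosh z.re * Real.cos z.im := by
  conv_lhs => rw [← re_add_im z]
  rw [cosh_add, cosh_mul_I, sinh_mul_I]
  simp [cosh_ofReal_re, sinh_ofReal_re, cos_ofReal_re, sin_ofReal_re]

lemma sinh_im (z : ℂ) : (sinh z).im = Real.cosh z.re * Real.sin z.im := by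
  conv_lhs => rw [← re_add_im z]
  rw [sinh_add, cosh_mul_I, sinh_mul_I]
  simp [cosh_ofReal_re, sinh_ofReal_re, cos_ofReal_re, sin_ofReal_re]

lemma norm_cosh_le (z : ℂ) : ‖cosh z‖ ≤ Real.cosh z.re := by
  rw [cosh, Real.cosh_eq, norm_div]
  have := norm_add_le (exp z) (exp (-z))
  rw [norm_exp, norm_exp, neg_re] at this
  simp only [norm_ofNat]
  gcongr

lemma norm_sinh_le (z : ℂ) : ‖sinh z‖ ≤ Real.cosh z.re := by
  rw [sinh, Real.cosh_eq, norm_div]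
  have := norm_sub_le (exp z) (exp (-z))
  rw [norm_exp, norm_exp, neg_re] at this
  simp only [norm_ofNat]
  gcongr

end Complex

/-- The holomorphic extension of `u e^(-u²/(2T)) √(cosh u - cosh s)`. -/
noncomputable def sabrKernel (T : ℝ) (s u : ℂ) : ℂ :=
  u * Complex.exp (-u ^ 2 / (2 * T)) * (Complex.cosh u - Complex.cosh s).sqrt

/-- The integral of `sabrKernel T s` over the horizontal ray issuing from `s`. -/
noncomputable def sabrTransform (T : ℝ) (s : ℂ) : ℂ :=
  ∫ r in Ioi (0 : ℝ), sabrKernel T s (s + r)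

lemma measurable_sabrKernel (T : ℝ) : Measurable fun p : ℂ × ℂ => sabrKernel T p.1 p.2 := by
  have := Complex.measurable_sqrt
  unfold sabrKernel
  fun_prop

lemma measurable_sabrKernel_comp {α : Type*} [MeasurableSpace α] (T : ℝ) {f g : α → ℂ}
    (hf : Measurable f) (hg : Measurable g) : Measurable fun a => sabrKernel T (f a) (g a) :=
  (measurable_sabrKernel T).comp (hf.prodMk hg)

lemma norm_sabrKernel_le {T : ℝ} (hT : 0 < T) {s u : ℂ} (hs : 0 ≤ s.re) (hsu : s.re ≤ u.re)
    (hu : |u.im| ≤ 2) :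
    ‖sabrKernel T s u‖ ≤ 4 * Real.exp (2 / T + 8 * T) * Real.exp (-2 * u.re) := by
  set p := u.re
  have hp : 0 ≤ p := hs.trans hsu
  have h1 : ‖u‖ ≤ 2 * Real.exp p := by
    have := Complex.norm_le_abs_re_add_abs_im u
    have e := Real.add_one_le_exp p
    rw [abs_of_nonneg hp] at this
    linarith [Real.one_le_exp hp]
  have h2 : ‖Complex.exp (-u ^ 2 / (2 * T))‖ ≤ Real.exp (2 / T - p ^ 2 / (2 * T)) := by
    rw [Complex.norm_exp]
    apply Real.exp_le_exp.2
    have : (-u ^ 2 / (2 * T)).re = (u.im ^ 2 - p ^ 2) / (2 * T) := by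
      rw [show (2 * (T : ℂ)) = ((2 * T : ℝ) : ℂ) by push_cast; ring, Complex.div_ofReal_re]
      simp [sq, p]
    rw [this]
    have : u.im ^ 2 ≤ 4 := by nlinarith [abs_le.1 hu]
    rw [show 2 / T - p ^ 2 / (2 * T) = (4 - p ^ 2) / (2 * T) by field_simp; ring]
    gcongr
  have h3 : ‖(Complex.cosh u - Complex.cosh s).sqrt‖ ≤ 2 * Real.exp p := by
    rw [Complex.norm_sqrt_eq]
    refine Real.sqrt_le_iff.2 ⟨by positivity, ?_⟩
    have a := norm_sub_le (Complex.cosh u) (Complex.cosh s)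
    have b := Complex.norm_cosh_le u
    have c := (Complex.norm_cosh_le s).trans
      (Real.cosh_le_cosh.2 (by rwa [abs_of_nonneg hs, abs_of_nonneg hp] : |s.re| ≤ |p|))
    have d : Real.cosh p ≤ Real.exp p := by
      rw [Real.cosh_eq]
      have := Real.exp_le_exp.2 (by linarith : -p ≤ p)
      linarith
    nlinarith [Real.one_le_exp hp]
  calc ‖sabrKernel T s u‖ = ‖u‖ * ‖Complex.exp (-u ^ 2 / (2 * T))‖ *
        ‖(Complex.cosh u - Complex.cosh s).sqrt‖ := by simp [sabrKernel]
    _ ≤ (2 * Real.exp p) * Real.exp (2 / T - p ^ 2 / (2 * T)) * (2 * Real.exp p) := by gcongr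
    _ = 4 * Real.exp (p + (2 / T - p ^ 2 / (2 * T)) + p) := by
        rw [Real.exp_add, Real.exp_add]; ring
    _ ≤ 4 * Real.exp ((2 / T + 8 * T) + (-2 * p)) := by
        refine mul_le_mul_of_nonneg_left (Real.exp_le_exp.2 ?_) (by norm_num)
        have : 4 * p ≤ 8 * T + p ^ 2 / (2 * T) := by
          have : 8 * T + p ^ 2 / (2 * T) - 4 * p = (p - 4 * T) ^ 2 / (2 * T) := by
            field_simp; ring
          have : 0 ≤ (p - 4 * T) ^ 2 / (2 * T) := by positivity
          linarith
        linarith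
    _ = _ := by rw [Real.exp_add]; ring

lemma cosh_sub_cosh_re_nonneg {s u : ℂ} (hs : 0 ≤ s.re) (hsu : s.re ≤ u.re) (hu : 0 ≤ u.im)
    (hus : u.im ≤ s.im) (hs' : s.im < π / 2) : 0 ≤ (Complex.cosh u - Complex.cosh s).re := by
  rw [Complex.sub_re, Complex.cosh_re, Complex.cosh_re, sub_nonneg]
  have h1 : Real.cosh s.re ≤ Real.cosh u.re :=
    Real.cosh_le_cosh.2 (by rwa [abs_of_nonneg hs, abs_of_nonneg (hs.trans hsu)])
  have h2 : Real.cos s.im ≤ Real.cos u.im :=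
    Real.cos_le_cos_of_nonneg_of_le_pi hu (by linarith [Real.pi_pos]) hus
  have h3 : 0 < Real.cos s.im := Real.cos_pos_of_mem_Ioo ⟨by linarith [Real.pi_pos], hs'⟩
  have := Real.cosh_pos s.re
  gcongr

lemma cosh_sub_cosh_re_pos {s u : ℂ} (hs : 0 ≤ s.re) (hsu : s.re < u.re) (hu : 0 ≤ u.im)
    (hus : u.im ≤ s.im) (hs' : s.im < π / 2) : 0 < (Complex.cosh u - Complex.cosh s).re := by
  rw [Complex.sub_re, Complex.cosh_re, Complex.cosh_re, sub_pos]
  have h1 : Real.cosh s.re < Real.cosh u.re :=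
    Real.cosh_lt_cosh.2 (by rwa [abs_of_nonneg hs, abs_of_nonneg (hs.trans hsu.le)])
  have h2 : Real.cos s.im ≤ Real.cos u.im :=
    Real.cos_le_cos_of_nonneg_of_le_pi hu (by linarith [Real.pi_pos]) hus
  have h3 : 0 < Real.cos s.im := Real.cos_pos_of_mem_Ioo ⟨by linarith [Real.pi_pos], hs'⟩
  have := Real.cosh_pos s.re
  calc _ < Real.cosh u.re * Real.cos s.im := by gcongr
    _ ≤ _ := by gcongr

lemma continuousAt_sabrKernel {T : ℝ} {s u : ℂ}
    (h : 0 ≤ (Complex.cosh u - Complex.cosh s).re) : ContinuousAt (sabrKernel T s) u := by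
  have h1 : ContinuousAt (fun u => (Complex.cosh u - Complex.cosh s).sqrt) u :=
    (Complex.continuousAt_sqrt_of_re_nonneg h).comp (f := fun u => Complex.cosh u - Complex.cosh s)
      (by fun_prop)
  unfold sabrKernel
  exact ContinuousAt.mul (by fun_prop) h1

lemma differentiableAt_sabrKernel {T : ℝ} {p q : ℂ → ℂ} {z : ℂ} (hp : DifferentiableAt ℂ p z)
    (hq : DifferentiableAt ℂ q z) (h : 0 < (Complex.cosh (q z) - Complex.cosh (p z)).re) :
    DifferentiableAt ℂ (fun z => sabrKernel T (p z) (q z)) z := by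
  have h1 : DifferentiableAt ℂ (fun z => (Complex.cosh (q z) - Complex.cosh (p z)).sqrt) z :=
    (Complex.differentiableAt_sqrt (Or.inl h)).comp z
      (f := fun z => Complex.cosh (q z) - Complex.cosh (p z))
      (by fun_prop)
  unfold sabrKernel
  exact DifferentiableAt.mul (by fun_prop) h1

/-- The horizontal ray from `s` may be replaced by the vertical segment down to the real axis
followed by a real ray. -/
lemma sabrTransform_eq {T x θ : ℝ} (hT : 0 < T) (hx : 0 ≤ x) (hθ : 0 ≤ θ) (hθ' : θ < π / 2) :
    sabrTransform T (x + θ * Complex.I) =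
      (∫ r in Ioi (0 : ℝ), sabrKernel T (x + θ * Complex.I) ((x + r : ℝ) : ℂ)) -
        Complex.I * ∫ y in (0 : ℝ)..θ, sabrKernel T (x + θ * Complex.I) (x + y * Complex.I) := by
  have h := integral_halfStrip_eq (f := fun w => sabrKernel T (x + θ * Complex.I) (x + w))
    (h := θ) (C := 4 * Real.exp (2 / T + 8 * T)) hθ ?_ ?_ ?_
  · simp only [sabrTransform]
    push_cast
    rw [h]
    ring_nf
  · intro z hz
    refine ContinuousAt.continuousWithinAt ?_
    refine ContinuousAt.comp (g := sabrKernel T (x + θ * Complex.I))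
      (f := fun w : ℂ => (x : ℂ) + w) (continuousAt_sabrKernel ?_) (by fun_prop)
    apply cosh_sub_cosh_re_nonneg <;> simp [hx, hz.1, hz.2.1, hz.2.2, hθ']
  · intro z h1 h2 h3
    refine differentiableAt_sabrKernel (p := fun _ => (x : ℂ) + θ * Complex.I)
      (q := fun w => (x : ℂ) + w) (by fun_prop) (by fun_prop) ?_
    apply cosh_sub_cosh_re_pos <;> simp [hx, h1, h2.le, h3.le, hθ']
  · intro z h1 h2
    refine (norm_sabrKernel_le hT (by simp [hx]) (by simp [h1]) ?_).trans ?_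
    · have := Real.pi_le_four
      simp only [Complex.add_im, Complex.ofReal_im, zero_add]
      rw [abs_of_nonneg h2.1]
      linarith [h2.2]
    · gcongr
      simp
      linarith

/-- The oscillating factor `e^(i b sinh s)`. -/
noncomputable def sabrPhase (b : ℝ) (s : ℂ) : ℂ := Complex.exp (Complex.I * b * Complex.sinh s)

lemma norm_sabrPhase (b x y : ℝ) : ‖sabrPhase b (x + y * Complex.I)‖ =
    Real.exp (-(b * (Real.cosh x * Real.sin y))) := by
  rw [sabrPhase, Complex.norm_exp]
  have : (Complex.I * b * Complex.sinh (x + y * Complex.I)).re =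
      -(b * (Complex.sinh (x + y * Complex.I)).im) := by
    simp [Complex.mul_re, Complex.mul_im]
  rw [this, Complex.sinh_im]
  simp

lemma norm_sabrPhase_le_one {b x y : ℝ} (hb : 0 ≤ b) (hy : 0 ≤ y) (hy' : y ≤ π) :
    ‖sabrPhase b (x + y * Complex.I)‖ ≤ 1 := by
  rw [norm_sabrPhase, Real.exp_le_one_iff]
  have := Real.sin_nonneg_of_nonneg_of_le_pi hy hy'
  have := Real.cosh_pos x
  simp only [Left.neg_nonpos_iff]
  positivity

lemma measurable_sabrPhase (b : ℝ) : Measurable (sabrPhase b) := by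
  unfold sabrPhase
  fun_prop

lemma norm_sabrKernel_shift_le {T : ℝ} (hT : 0 < T) {x y r : ℝ} (hx : 0 ≤ x) (hr : 0 ≤ r)
    (hy : 0 ≤ y) (hy' : y < π / 2) :
    ‖sabrKernel T (x + y * Complex.I) (x + y * Complex.I + r)‖ ≤
      4 * Real.exp (2 / T + 8 * T) * (Real.exp (-2 * x) * Real.exp (-2 * r)) := by
  have h4 := Real.pi_le_four
  refine (norm_sabrKernel_le hT (by simp [hx]) (by simp [hr]) ?_).trans_eq ?_
  · simp only [Complex.add_im, Complex.ofReal_im, Complex.mul_im, Complex.I_im, Complex.I_re]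
    rw [abs_le]
    constructor <;> simp <;> linarith
  · rw [← Real.exp_add]
    simp
    ring

lemma integrable_sabrPhase_mul_sabrKernel {T b y : ℝ} (hT : 0 < T) (hb : 0 ≤ b) (hy : 0 ≤ y)
    (hy' : y < π / 2) :
    Integrable (fun p : ℝ × ℝ => sabrPhase b (p.1 + y * Complex.I) *
      sabrKernel T (p.1 + y * Complex.I) (p.1 + y * Complex.I + p.2))
      ((volume.restrict (Ioi 0)).prod (volume.restrict (Ioi 0))) := by
  have e := integrableOn_exp_mul_Ioi (by norm_num : (-2 : ℝ) < 0) 0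
  refine Integrable.mono' ((e.mul_prod e).const_mul (4 * Real.exp (2 / T + 8 * T))) ?_ ?_
  · refine Measurable.aestronglyMeasurable (Measurable.mul ?_ ?_)
    · exact (measurable_sabrPhase b).comp (by fun_prop)
    · exact measurable_sabrKernel_comp T (by fun_prop) (by fun_prop)
  · rw [Measure.prod_restrict]
    refine (ae_restrict_iff' (measurableSet_Ioi.prod measurableSet_Ioi)).2 (.of_forall ?_)
    rintro ⟨x, r⟩ ⟨hx, hr⟩
    rw [norm_mul]
    have h1 := norm_sabrPhase_le_one (x := x) hb hy (by linarith [Real.pi_pos])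
    have h2 := norm_sabrKernel_shift_le hT (le_of_lt hx) (le_of_lt hr) hy hy'
    exact (mul_le_mul h1 h2 (norm_nonneg _) zero_le_one).trans_eq (one_mul _)

lemma integrable_sabrPhase_mul_sabrKernel_vertical {T b h : ℝ} (hT : 0 < T) (hb : 0 ≤ b)
    (hh' : h < π / 2) :
    Integrable (fun p : ℝ × ℝ => sabrPhase b (p.1 * Complex.I) *
      sabrKernel T (p.1 * Complex.I) (p.1 * Complex.I + p.2))
      ((volume.restrict (Ioc 0 h)).prod (volume.restrict (Ioi 0))) := by
  have e := integrableOn_exp_mul_Ioi (by norm_num : (-2 : ℝ) < 0) 0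
  have e1 : Integrable (fun _ : ℝ => (1 : ℝ)) (volume.restrict (Ioc 0 h)) := by simp
  refine Integrable.mono' ((e1.mul_prod e).const_mul (4 * Real.exp (2 / T + 8 * T))) ?_ ?_
  · refine Measurable.aestronglyMeasurable (Measurable.mul ?_ ?_)
    · exact (measurable_sabrPhase b).comp (by fun_prop)
    · exact measurable_sabrKernel_comp T (by fun_prop) (by fun_prop)
  · rw [Measure.prod_restrict]
    refine (ae_restrict_iff' (measurableSet_Ioc.prod measurableSet_Ioi)).2 (.of_forall ?_)
    rintro ⟨y, r⟩ ⟨hy, hr⟩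
    rw [norm_mul]
    have h1 := norm_sabrPhase_le_one (x := 0) hb hy.1.le (by linarith [Real.pi_pos, hy.2])
    have h2 := norm_sabrKernel_shift_le hT le_rfl (le_of_lt hr) hy.1.le (by linarith [hy.2])
    simp only [Complex.ofReal_zero, zero_add, mul_zero, Real.exp_zero] at h1 h2
    exact (mul_le_mul h1 h2 (norm_nonneg _) zero_le_one).trans_eq (one_mul _)

/-- Shifting the contour of `∫ e^(i b sinh s) sabrTransform T s ds` from the positive real axis to
height `h`. -/
lemma integral_sabrPhase_mul_sabrTransform {T b h : ℝ} (hT : 0 < T) (hb : 0 ≤ b) (hh : 0 ≤ h)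
    (hh' : h < π / 2) :
    ∫ x in Ioi (0 : ℝ), sabrPhase b x * sabrTransform T x =
      (∫ x in Ioi (0 : ℝ), sabrPhase b (x + h * Complex.I) * sabrTransform T (x + h * Complex.I)) +
        Complex.I * ∫ θ in (0 : ℝ)..h,
          sabrPhase b (θ * Complex.I) * sabrTransform T (θ * Complex.I) := by
  have i0 := integrable_sabrPhase_mul_sabrKernel hT hb le_rfl (by positivity : 0 < π / 2)
  have i1 := integrable_sabrPhase_mul_sabrKernel hT hb hh hh'
  have i2 := integrable_sabrPhase_mul_sabrKernel_vertical hT hb hh'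
  simp only [Complex.ofReal_zero, zero_mul, add_zero] at i0
  have key : ∀ r ∈ Ioi (0 : ℝ),
      ∫ x in Ioi (0 : ℝ), sabrPhase b x * sabrKernel T x (x + r) =
      (∫ x in Ioi (0 : ℝ), sabrPhase b (x + h * Complex.I) *
        sabrKernel T (x + h * Complex.I) (x + h * Complex.I + r)) +
      Complex.I * ∫ θ in Ioc 0 h, sabrPhase b (θ * Complex.I) *
        sabrKernel T (θ * Complex.I) (θ * Complex.I + r) := by
    intro r hr
    rw [← intervalIntegral.integral_of_le hh]
    have hd : ∀ z : ℂ, 0 ≤ z.re → 0 ≤ z.im → z.im ≤ h →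
        DifferentiableAt ℂ (fun s => sabrPhase b s * sabrKernel T s (s + r)) z := by
      intro z h1 h2 h3
      refine DifferentiableAt.mul (by unfold sabrPhase; fun_prop)
        (differentiableAt_sabrKernel (by fun_prop) (by fun_prop) ?_)
      refine cosh_sub_cosh_re_pos h1 ?_ ?_ ?_ ?_ <;> simp_all
      linarith
    refine integral_halfStrip_eq (f := fun s => sabrPhase b s * sabrKernel T s (s + r))
      (C := 4 * Real.exp (2 / T + 8 * T)) hh
      (fun z hz => (hd z hz.1 hz.2.1 hz.2.2).continuousAt.continuousWithinAt)
      (fun z h1 h2 h3 => hd z h1.le h2.le h3.le) ?_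
    intro z h1 h2
    have a1 := norm_sabrPhase_le_one (x := z.re) hb h2.1 (by linarith [Real.pi_pos, h2.2])
    have a2 := norm_sabrKernel_shift_le hT h1 (le_of_lt hr) h2.1 (h2.2.trans_lt hh')
    rw [Complex.re_add_im] at a1 a2
    rw [norm_mul]
    refine (mul_le_mul a1 a2 (norm_nonneg _) zero_le_one).trans ?_
    rw [one_mul, ← Real.exp_add]
    gcongr
    linarith [mem_Ioi.1 hr]
  have s0 := integral_integral_swap
    (f := fun x r : ℝ => sabrPhase b x * sabrKernel T x (x + r)) i0
  have s1 := integral_integral_swap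
    (f := fun x r : ℝ => sabrPhase b (x + h * Complex.I) *
      sabrKernel T (x + h * Complex.I) (x + h * Complex.I + r)) i1
  have s2 := integral_integral_swap
    (f := fun θ r : ℝ => sabrPhase b (θ * Complex.I) *
      sabrKernel T (θ * Complex.I) (θ * Complex.I + r)) i2
  simp only [integral_const_mul] at s0 s1 s2
  rw [intervalIntegral.integral_of_le hh]
  unfold sabrTransform
  rw [s0, s1, s2, setIntegral_congr_fun measurableSet_Ioi key, integral_add, integral_const_mul]
  · exact i1.integral_prod_right
  · exact i2.integral_prod_right.const_mul _

/-- The restriction of `sabrTransform T` to the nonnegative real axis. -/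
noncomputable def sabrTransformReal (T x : ℝ) : ℝ :=
  ∫ r in Ioi (0 : ℝ), (x + r) * Real.exp (-(x + r) ^ 2 / (2 * T)) *
    √(Real.cosh (x + r) - Real.cosh x)

lemma sabrKernel_ofReal (T : ℝ) {x u : ℝ} (hx : 0 ≤ x) (hu : x ≤ u) :
    sabrKernel T x u =
      ((u * Real.exp (-u ^ 2 / (2 * T)) * √(Real.cosh u - Real.cosh x) : ℝ) : ℂ) := by
  have : Real.cosh x ≤ Real.cosh u :=
    Real.cosh_le_cosh.2 (by rwa [abs_of_nonneg hx, abs_of_nonneg (hx.trans hu)])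
  push_cast
  rw [← Complex.sqrt_ofReal_of_nonneg (sub_nonneg.2 this)]
  push_cast
  rfl

lemma sabrTransform_ofReal (T : ℝ) {x : ℝ} (hx : 0 ≤ x) :
    sabrTransform T x = sabrTransformReal T x := by
  rw [sabrTransform, sabrTransformReal, ← integral_complex_ofReal]
  refine setIntegral_congr_fun measurableSet_Ioi fun r hr => ?_
  simpa using sabrKernel_ofReal T hx (by linarith [mem_Ioi.1 hr] : x ≤ x + r)

lemma sabrTransform_mul_I_im {T θ : ℝ} (hT : 0 < T) (hθ : 0 ≤ θ) (hθ' : θ < π / 2) :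
    (sabrTransform T (θ * Complex.I)).im = 0 := by
  have h := sabrTransform_eq hT le_rfl hθ hθ'
  simp only [Complex.ofReal_zero, zero_add] at h
  have h1 : ∫ r in Ioi (0 : ℝ), sabrKernel T (θ * Complex.I) r =
      ((∫ r in Ioi (0 : ℝ), r * Real.exp (-r ^ 2 / (2 * T)) *
        √(Real.cosh r - Real.cos θ) : ℝ) : ℂ) := by
    rw [← integral_complex_ofReal]
    refine setIntegral_congr_fun measurableSet_Ioi fun r hr => ?_
    have : 0 ≤ Real.cosh r - Real.cos θ := by
      linarith [Real.one_le_cosh r, Real.cos_le_one θ]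
    push_cast
    rw [← Complex.sqrt_ofReal_of_nonneg this]
    simp [sabrKernel, Complex.cosh_mul_I]
  have h2 : ∫ y in (0 : ℝ)..θ, sabrKernel T (θ * Complex.I) (y * Complex.I) =
      Complex.I * ((∫ y in (0 : ℝ)..θ, y * Real.exp (y ^ 2 / (2 * T)) *
        √(Real.cos y - Real.cos θ) : ℝ) : ℂ) := by
    rw [← intervalIntegral.integral_ofReal, ← intervalIntegral.integral_const_mul]
    refine intervalIntegral.integral_congr fun y hy => ?_
    rw [uIcc_of_le hθ] at hy
    have : 0 ≤ Real.cos y - Real.cos θ := by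
      linarith [Real.cos_le_cos_of_nonneg_of_le_pi hy.1 (by linarith [Real.pi_pos]) hy.2]
    push_cast
    rw [← Complex.sqrt_ofReal_of_nonneg this]
    simp [sabrKernel, Complex.cosh_mul_I, mul_pow]
    ring
  rw [h, h1, h2, ← mul_assoc, Complex.I_mul_I]
  simp

lemma norm_sabrTransform_le {T x y : ℝ} (hT : 0 < T) (hx : 0 ≤ x) (hy : 0 ≤ y)
    (hy' : y < π / 2) :
    ‖sabrTransform T (x + y * Complex.I)‖ ≤
      4 * Real.exp (2 / T + 8 * T) * Real.exp (-2 * x) := by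
  have e := integrableOn_exp_mul_Ioi (by norm_num : (-2 : ℝ) < 0) 0
  have h1 := norm_integral_le_of_norm_le
    (e.const_mul (4 * Real.exp (2 / T + 8 * T) * Real.exp (-2 * x)))
    ((ae_restrict_iff' measurableSet_Ioi).2 (.of_forall fun r hr =>
      (norm_sabrKernel_shift_le hT hx (le_of_lt hr) hy hy').trans_eq (by ring)))
  refine h1.trans ?_
  rw [integral_const_mul, integral_exp_mul_Ioi (by norm_num)]
  have : 0 < 4 * Real.exp (2 / T + 8 * T) * Real.exp (-2 * x) := by positivity
  have e2 : -Real.exp (-2 * 0) / -2 = 1 / 2 := by norm_num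
  rw [e2]
  linarith

lemma stronglyMeasurable_sabrTransform (T : ℝ) : StronglyMeasurable (sabrTransform T) := by
  unfold sabrTransform
  refine StronglyMeasurable.integral_prod_right'
    (f := fun p : ℂ × ℝ => sabrKernel T p.1 (p.1 + p.2)) ?_
  exact (measurable_sabrKernel_comp T (by fun_prop) (by fun_prop)).stronglyMeasurable

lemma measurable_sabrTransformReal (T : ℝ) : Measurable (sabrTransformReal T) := by
  unfold sabrTransformReal
  refine (StronglyMeasurable.integral_prod_right' (f := fun p : ℝ × ℝ => (p.1 + p.2) *
    Real.exp (-(p.1 + p.2) ^ 2 / (2 * T)) * √(Real.cosh (p.1 + p.2) - Real.cosh p.1)) ?_).measurable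
  exact Measurable.stronglyMeasurable (by fun_prop)

lemma abs_sabrTransformReal_le {T x : ℝ} (hT : 0 < T) (hx : 0 ≤ x) :
    |sabrTransformReal T x| ≤ 4 * Real.exp (2 / T + 8 * T) * Real.exp (-2 * x) := by
  have := norm_sabrTransform_le hT hx le_rfl (by positivity : 0 < π / 2)
  simpa [sabrTransform_ofReal T hx] using this

lemma integral_cos_mul_sabrTransformReal {T b h : ℝ} (hT : 0 < T) (hb : 0 ≤ b) (hh : 0 ≤ h)
    (hh' : h < π / 2) :
    ∫ x in Ioi (0 : ℝ), Real.cos (b * Real.sinh x) * sabrTransformReal T x =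
      (∫ x in Ioi (0 : ℝ), sabrPhase b (x + h * Complex.I) *
        sabrTransform T (x + h * Complex.I)).re := by
  have h0 := integral_sabrPhase_mul_sabrTransform hT hb hh hh'
  have h1 : ∫ θ in (0 : ℝ)..h, sabrPhase b (θ * Complex.I) * sabrTransform T (θ * Complex.I) =
      ((∫ θ in (0 : ℝ)..h, Real.exp (-(b * Real.sin θ)) *
        (sabrTransform T (θ * Complex.I)).re : ℝ) : ℂ) := by
    rw [← intervalIntegral.integral_ofReal]
    refine intervalIntegral.integral_congr fun θ hθ => ?_
    rw [uIcc_of_le hh] at hθ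
    have : sabrTransform T (θ * Complex.I) = ((sabrTransform T (θ * Complex.I)).re : ℂ) := by
      apply Complex.ext <;> simp [sabrTransform_mul_I_im hT hθ.1 (hθ.2.trans_lt hh')]
    simp only [sabrPhase, Complex.sinh_mul_I]
    rw [this]
    push_cast
    congr 2
    linear_combination (b : ℂ) * Complex.sin θ * Complex.I_mul_I
  have i0 := (integrable_sabrPhase_mul_sabrKernel hT hb le_rfl
    (by positivity : 0 < π / 2)).integral_prod_left
  simp only [Complex.ofReal_zero, zero_mul, add_zero, integral_const_mul] at i0
  have h2 := congrArg Complex.re h0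
  rw [h1] at h2
  simp only [Complex.add_re, Complex.mul_re, Complex.I_re, Complex.I_im, Complex.ofReal_im,
    Complex.ofReal_re, zero_mul, mul_zero, sub_zero, add_zero] at h2
  rw [← h2]
  have := integral_re i0
  simp only [RCLike.re_to_complex] at this
  refine Eq.trans ?_ this
  refine setIntegral_congr_fun measurableSet_Ioi fun x hx => ?_
  have e : sabrPhase b x * (∫ r in Ioi (0 : ℝ), sabrKernel T x (x + r)) =
    sabrPhase b x * (sabrTransformReal T x : ℂ) := by
    rw [← sabrTransform_ofReal T (le_of_lt hx)]; rfl
  rw [e, Complex.re_mul_ofReal, sabrPhase, ← Complex.ofReal_sinh, mul_assoc, ← Complex.ofReal_mul,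
    mul_comm Complex.I, Complex.exp_ofReal_mul_I_re]

lemma setIntegral_Ioi_comp_add (f : ℝ → ℝ) (s : ℝ) :
    ∫ r in Ioi (0 : ℝ), f (s + r) = ∫ u in Ioi s, f u := by
  have h := (measurePreserving_add_left (volume : Measure ℝ) s).setIntegral_preimage_emb
    (measurableEmbedding_addLeft s) f (Ioi s)
  rw [← h]
  congr 2
  ext r
  simp

lemma mul_exp_mul_sqrt_nonneg {s u : ℝ} (T : ℝ) (hs : 0 ≤ s) (hu : s ≤ u) :
    0 ≤ u * Real.exp (-u ^ 2 / (2 * T)) * √(Real.cosh u - Real.cosh s) := by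
  have := hs.trans hu
  positivity

lemma mul_exp_mul_sqrt_le {T s u : ℝ} (hT : 0 < T) (hs : 0 ≤ s) (hu : s ≤ u) :
    u * Real.exp (-u ^ 2 / (2 * T)) * √(Real.cosh u - Real.cosh s) ≤
      4 * Real.exp (2 / T + 8 * T) * Real.exp (-2 * u) := by
  have h := norm_sabrKernel_le hT (s := s) (u := u) (by simpa) (by simpa) (by simp)
  rw [sabrKernel_ofReal T hs hu, Complex.norm_real] at h
  exact (le_abs_self _).trans h

lemma hasIntegral_exp_mul_sinh_div_sqrt {T s : ℝ} (hT : 0 < T) (hs : 0 ≤ s) :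
    IntegrableOn (fun u => Real.exp (-u ^ 2 / (2 * T)) *
        (Real.sinh u / √(Real.cosh u - Real.cosh s))) (Ioi s) ∧
      ∫ u in Ioi s, Real.exp (-u ^ 2 / (2 * T)) *
        (Real.sinh u / √(Real.cosh u - Real.cosh s)) = 2 / T * sabrTransformReal T s := by
  set f : ℝ → ℝ := fun u => u * Real.exp (-u ^ 2 / (2 * T)) * √(Real.cosh u - Real.cosh s)
  set C := 4 * Real.exp (2 / T + 8 * T)
  have hfc : Continuous f := by fun_prop
  have hfi : IntegrableOn f (Ioi s) := by
    refine Integrable.mono' ((integrableOn_exp_mul_Ioi (by norm_num : (-2 : ℝ) < 0) s).const_mul C)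
      hfc.aestronglyMeasurable ((ae_restrict_iff' measurableSet_Ioi).2 (.of_forall fun u hu => ?_))
    rw [Real.norm_of_nonneg (mul_exp_mul_sqrt_nonneg T hs (le_of_lt hu))]
    exact mul_exp_mul_sqrt_le hT hs (le_of_lt hu)
  set Q : ℝ → ℝ := fun u => 2 * (Real.exp (-u ^ 2 / (2 * T)) * √(Real.cosh u - Real.cosh s)) +
    2 / T * ∫ v in s..u, f v
  have hpos : ∀ u ∈ Ioi s, 0 < Real.cosh u - Real.cosh s := fun u hu => by
    rw [sub_pos, Real.cosh_lt_cosh, abs_of_nonneg hs, abs_of_nonneg (hs.trans (le_of_lt hu))]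
    exact hu
  have hQd : ∀ u ∈ Ioi s, HasDerivAt Q (Real.exp (-u ^ 2 / (2 * T)) *
        (Real.sinh u / √(Real.cosh u - Real.cosh s))) u := by
    intro u hu
    have d1 : HasDerivAt (fun u => ∫ v in s..u, f v) (f u) u :=
      intervalIntegral.integral_hasDerivAt_right (hfc.intervalIntegrable _ _)
        (hfc.stronglyMeasurableAtFilter _ _) hfc.continuousAt
    have d2 : HasDerivAt (fun u : ℝ => Real.exp (-u ^ 2 / (2 * T)))
        (Real.exp (-u ^ 2 / (2 * T)) * (-(2 * u) / (2 * T))) u := by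
      have := (((hasDerivAt_id u).pow 2).neg.div_const (2 * T)).exp
      convert this using 2 <;> simp
    have d3 : HasDerivAt (fun u => √(Real.cosh u - Real.cosh s))
        (Real.sinh u / (2 * √(Real.cosh u - Real.cosh s))) u :=
      ((Real.hasDerivAt_cosh u).sub_const _).sqrt (hpos u hu).ne'
    have := ((d2.mul d3).const_mul 2).add (d1.const_mul (2 / T))
    refine this.congr_deriv ?_
    have := Real.sqrt_pos.2 (hpos u hu)
    simp only [f]
    field_simp
    ring
  have hQ0 : ∀ u ∈ Ioi s, 0 ≤ Real.exp (-u ^ 2 / (2 * T)) *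
        (Real.sinh u / √(Real.cosh u - Real.cosh s)) := fun u hu => by
    have : 0 ≤ Real.sinh u := Real.sinh_nonneg_iff.2 (hs.trans (le_of_lt hu))
    positivity
  have hQl : Tendsto Q atTop (𝓝 (2 / T * sabrTransformReal T s)) := by
    have t1 : Tendsto (fun u => Real.exp (-u ^ 2 / (2 * T)) * √(Real.cosh u - Real.cosh s)) atTop
        (𝓝 0) := by
      have t : Tendsto (fun u => C * Real.exp (-2 * u)) atTop (𝓝 0) := by
        have : Tendsto (fun u : ℝ => (-2) * u) atTop atBot :=
          tendsto_id.const_mul_atTop_of_neg (by norm_num)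
        simpa using (Real.tendsto_exp_atBot.comp this).const_mul C
      refine squeeze_zero' (.of_forall fun u => by positivity) ?_ t
      filter_upwards [eventually_ge_atTop 1, eventually_ge_atTop s] with u hu hu'
      refine le_trans ?_ (mul_exp_mul_sqrt_le hT hs hu')
      rw [mul_assoc]
      exact le_mul_of_one_le_left (by positivity) hu
    have t2 := intervalIntegral_tendsto_integral_Ioi s hfi tendsto_id
    have := (t1.const_mul 2).add (t2.const_mul (2 / T))
    rw [← setIntegral_Ioi_comp_add, mul_zero, zero_add] at this
    exact this
  have hQc : ContinuousWithinAt Q (Ici s) s := by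
    have d1 : HasDerivAt (fun u => ∫ v in s..u, f v) (f s) s :=
      intervalIntegral.integral_hasDerivAt_right (hfc.intervalIntegrable _ _)
        (hfc.stronglyMeasurableAtFilter _ _) hfc.continuousAt
    refine ContinuousAt.continuousWithinAt (ContinuousAt.add (by fun_prop) ?_)
    exact d1.continuousAt.const_mul _
  refine ⟨integrableOn_Ioi_deriv_of_nonneg hQc hQd hQ0 hQl, ?_⟩
  rw [integral_Ioi_of_hasDerivAt_of_nonneg hQc hQd hQ0 hQl]
  simp [Q]

lemma sabrTransformReal_nonneg (T : ℝ) {s : ℝ} (hs : 0 ≤ s) : 0 ≤ sabrTransformReal T s :=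
  setIntegral_nonneg measurableSet_Ioi fun r hr =>
    mul_exp_mul_sqrt_nonneg T hs (by linarith [mem_Ioi.1 hr])

lemma abs_sin_mul_sinh_div_le (a s : ℝ) : |Real.sin (a * Real.sinh s) / Real.sinh s| ≤ |a| := by
  rcases eq_or_ne (Real.sinh s) 0 with h | h
  · simp [h]
  rw [abs_div, div_le_iff₀ (abs_pos.2 h), ← abs_mul]
  exact Real.abs_sin_le_abs

lemma integral_exp_mul_sabrPayoff {T : ℝ} (hT : 0 < T) (a : ℝ) :
    ∫ u in Ioi (0 : ℝ), Real.exp (-u ^ 2 / (2 * T)) * sabrPayoff (2 * a) u =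
      2 / T * ∫ s in Ioi (0 : ℝ), Real.sin (a * Real.sinh s) / Real.sinh s *
        sabrTransformReal T s := by
  set φ : ℝ → ℝ := fun s => Real.sin (a * Real.sinh s) / Real.sinh s
  set J : ℝ → ℝ → ℝ := fun s u => Real.exp (-u ^ 2 / (2 * T)) *
        (Real.sinh u / √(Real.cosh u - Real.cosh s))
  set F : ℝ → ℝ → ℝ := fun u s => (Ioi s).indicator (fun u => φ s * J s u) u
  have hJ0 : ∀ s ∈ Ioi (0 : ℝ), ∀ u ∈ Ioi s, 0 ≤ J s u := fun s hs u hu => by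
    have : 0 ≤ Real.sinh u := Real.sinh_nonneg_iff.2 (le_of_lt (lt_trans hs hu))
    positivity
  have hm : Measurable (Function.uncurry F) := by
    have : Function.uncurry F = {p : ℝ × ℝ | p.2 < p.1}.indicator (fun p => φ p.2 * J p.2 p.1) := by
      ext ⟨u, s⟩
      simp [F, indicator]
    rw [this]
    refine Measurable.indicator ?_ (measurableSet_lt measurable_snd measurable_fst)
    fun_prop
  have hsec : ∀ s ∈ Ioi (0 : ℝ), ∀ G : ℝ → ℝ,
      ∫ u in Ioi (0 : ℝ), (Ioi s).indicator G u = ∫ u in Ioi s, G u := fun s hs G => by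
    rw [setIntegral_indicator measurableSet_Ioi, inter_eq_right.2 (Ioi_subset_Ioi (le_of_lt hs))]
  have hi : Integrable (Function.uncurry F)
      ((volume.restrict (Ioi 0)).prod (volume.restrict (Ioi 0))) := by
    refine (integrable_prod_iff' hm.aestronglyMeasurable).2 ⟨?_, ?_⟩
    · refine (ae_restrict_iff' measurableSet_Ioi).2 (.of_forall fun s hs => ?_)
      have := (hasIntegral_exp_mul_sinh_div_sqrt hT (le_of_lt hs)).1.const_mul (φ s)
      exact ((integrable_indicator_iff measurableSet_Ioi).2 this).restrict
    · have e := (integrableOn_exp_mul_Ioi (by norm_num : (-2 : ℝ) < 0) 0).const_mul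
        (|a| * (2 / T * (4 * Real.exp (2 / T + 8 * T))))
      refine Integrable.mono' e ?_ ?_
      · exact (hm.norm.comp
          measurable_swap).stronglyMeasurable.integral_prod_right'.aestronglyMeasurable
      refine (ae_restrict_iff' measurableSet_Ioi).2 (.of_forall fun s hs => ?_)
      have : ∫ u in Ioi (0 : ℝ), ‖F u s‖ = |φ s| * (2 / T * sabrTransformReal T s) := by
        rw [← (hasIntegral_exp_mul_sinh_div_sqrt hT (le_of_lt hs)).2, ← integral_const_mul]
        simp only [F, norm_indicator_eq_indicator_norm]
        rw [hsec s hs]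
        refine setIntegral_congr_fun measurableSet_Ioi fun u hu => ?_
        simp only [norm_mul, Real.norm_eq_abs, abs_of_nonneg (hJ0 s hs u hu)]
        rfl
      simp only [Function.uncurry]
      rw [this]
      have h0 := sabrTransformReal_nonneg T (le_of_lt hs)
      have h1 := (le_abs_self _).trans (abs_sabrTransformReal_le hT (le_of_lt hs))
      rw [Real.norm_of_nonneg (by positivity), mul_assoc, mul_assoc (2 / T)]
      refine mul_le_mul (abs_sin_mul_sinh_div_le a s) ?_ (by positivity) (abs_nonneg a)
      gcongr
  have hL : ∀ u ∈ Ioi (0 : ℝ), Real.exp (-u ^ 2 / (2 * T)) * sabrPayoff (2 * a) u =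
      ∫ s in Ioi (0 : ℝ), F u s := by
    intro u hu
    have : ∀ s, F u s = (Iio u).indicator (fun s => φ s * J s u) s := fun s => by
      simp [F, indicator]
    simp only [this]
    rw [setIntegral_indicator measurableSet_Iio, Ioi_inter_Iio, ← integral_Ioc_eq_integral_Ioo,
      ← intervalIntegral.integral_of_le (le_of_lt hu), sabrPayoff, ← mul_assoc,
      ← intervalIntegral.integral_const_mul]
    refine intervalIntegral.integral_congr fun s _ => ?_
    simp only [φ, J]
    rw [mul_div_cancel_left₀ a two_ne_zero]
    ring
  rw [setIntegral_congr_fun measurableSet_Ioi hL, integral_integral_swap hi, ← integral_const_mul]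
  refine setIntegral_congr_fun measurableSet_Ioi fun s hs => ?_
  simp only [F]
  rw [hsec s hs, integral_const_mul, (hasIntegral_exp_mul_sinh_div_sqrt hT (le_of_lt hs)).2]
  ring

/-- The cosine transform of `sabrTransformReal T` in the variable `sinh s`. -/
noncomputable def sabrCosTransform (T b : ℝ) : ℝ :=
  ∫ x in Ioi (0 : ℝ), Real.cos (b * Real.sinh x) * sabrTransformReal T x

lemma integrable_mul_cos_mul_sabrTransformReal {T : ℝ} (hT : 0 < T) {s : Set ℝ} {w : ℝ → ℝ}
    (hw : IntegrableOn w s) :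
    Integrable (fun p : ℝ × ℝ => w p.1 * (Real.cos (p.1 * Real.sinh p.2) *
      sabrTransformReal T p.2)) ((volume.restrict s).prod (volume.restrict (Ioi 0))) := by
  have e := integrableOn_exp_mul_Ioi (by norm_num : (-2 : ℝ) < 0) 0
  have hG : IntegrableOn (sabrTransformReal T) (Ioi 0) := by
    refine Integrable.mono' (e.const_mul (4 * Real.exp (2 / T + 8 * T)))
      (measurable_sabrTransformReal T).aestronglyMeasurable
      ((ae_restrict_iff' measurableSet_Ioi).2 (.of_forall fun x hx => ?_))
    exact abs_sabrTransformReal_le hT (le_of_lt hx)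
  have := (hw.mul_prod hG).bdd_mul (c := 1)
    (f := fun p : ℝ × ℝ => Real.cos (p.1 * Real.sinh p.2))
    (Measurable.aestronglyMeasurable (by fun_prop)) (.of_forall fun p => Real.abs_cos_le_one _)
  refine this.congr (.of_forall fun p => ?_)
  simp only
  ring

lemma integral_sin_mul_sabrTransformReal {T a : ℝ} (hT : 0 < T) (ha : 0 ≤ a) :
    ∫ s in Ioi (0 : ℝ), Real.sin (a * Real.sinh s) / Real.sinh s * sabrTransformReal T s =
      ∫ b in Ioc 0 a, sabrCosTransform T b := by
  have h := integrable_mul_cos_mul_sabrTransformReal hT (s := Ioc 0 a) (w := fun _ => 1) (by simp)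
  simp only [one_mul] at h
  unfold sabrCosTransform
  rw [integral_integral_swap (f := fun b x : ℝ => Real.cos (b * Real.sinh x) *
    sabrTransformReal T x) h]
  refine setIntegral_congr_fun measurableSet_Ioi fun s hs => ?_
  have : Real.sinh s ≠ 0 := (Real.sinh_pos_iff.2 hs).ne'
  rw [integral_mul_const, ← intervalIntegral.integral_of_le ha,
    intervalIntegral.integral_comp_mul_right _ this]
  simp
  left
  ring

lemma integral_exp_neg_mul_cos {ε : ℝ} (hε : 0 < ε) (y : ℝ) :
    ∫ b in Ioi (0 : ℝ), Real.exp (-ε * b) * Real.cos (b * y) = ε / (ε ^ 2 + y ^ 2) := by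
  have hre : (-ε + y * Complex.I : ℂ).re < 0 := by simpa
  have h := integral_exp_mul_complex_Ioi hre 0
  have hi := integrableOn_exp_mul_complex_Ioi hre 0
  have h2 := integral_re hi
  rw [h] at h2
  simp only [RCLike.re_to_complex] at h2
  have e : ∀ b : ℝ, (Complex.exp ((-ε + y * Complex.I) * b)).re =
      Real.exp (-ε * b) * Real.cos (b * y) := fun b => by
    rw [Complex.exp_re]
    simp [mul_comm]
  simp only [e] at h2
  rw [h2]
  simp [Complex.div_re, Complex.normSq_apply]
  ring

lemma sabrCosTransform_eq {T b h : ℝ} (hT : 0 < T) (hb : 0 ≤ b) (hh : 0 ≤ h) (hh' : h < π / 2) :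
    sabrCosTransform T b = (∫ x in Ioi (0 : ℝ), sabrPhase b (x + h * Complex.I) *
        sabrTransform T (x + h * Complex.I)).re :=
  integral_cos_mul_sabrTransformReal hT hb hh hh'

lemma norm_sabrPhase_mul_sabrTransform_le {T b h x : ℝ} (hT : 0 < T) (hb : 0 ≤ b) (hh : 0 ≤ h)
    (hh' : h < π / 2) (hx : 0 ≤ x) :
    ‖sabrPhase b (x + h * Complex.I) * sabrTransform T (x + h * Complex.I)‖ ≤
      4 * Real.exp (2 / T + 8 * T) * (Real.exp (-Real.sin h * b) * Real.exp (-2 * x)) := by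
  rw [norm_mul, norm_sabrPhase]
  have h1 := norm_sabrTransform_le hT hx hh hh'
  have h2 : Real.exp (-(b * (Real.cosh x * Real.sin h))) ≤ Real.exp (-Real.sin h * b) := by
    apply Real.exp_le_exp.2
    have : 0 ≤ Real.sin h := Real.sin_nonneg_of_nonneg_of_le_pi hh (by linarith [Real.pi_pos])
    nlinarith [mul_le_mul_of_nonneg_left (Real.one_le_cosh x) (mul_nonneg hb this)]
  calc _ ≤ Real.exp (-Real.sin h * b) * (4 * Real.exp (2 / T + 8 * T) * Real.exp (-2 * x)) := by
        gcongr
    _ = _ := by ring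

lemma integrable_sabrPhase_mul_sabrTransform {T h : ℝ} (hT : 0 < T) (hh : 0 < h)
    (hh' : h < π / 2) {a : ℝ} (ha : 0 ≤ a) :
    Integrable (fun p : ℝ × ℝ => sabrPhase p.1 (p.2 + h * Complex.I) *
        sabrTransform T (p.2 + h * Complex.I))
      ((volume.restrict (Ioi a)).prod (volume.restrict (Ioi 0))) := by
  have hs : 0 < Real.sin h := Real.sin_pos_of_pos_of_lt_pi hh (by linarith [Real.pi_pos])
  have e := integrableOn_exp_mul_Ioi (by norm_num : (-2 : ℝ) < 0) 0
  have e' := integrableOn_exp_mul_Ioi (neg_lt_zero.2 hs) a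
  refine Integrable.mono' ((e'.mul_prod e).const_mul (4 * Real.exp (2 / T + 8 * T))) ?_ ?_
  · refine Measurable.aestronglyMeasurable (Measurable.mul ?_ ?_)
    · unfold sabrPhase
      fun_prop
    · exact (stronglyMeasurable_sabrTransform T).measurable.comp (by fun_prop)
  · rw [Measure.prod_restrict]
    refine (ae_restrict_iff' (measurableSet_Ioi.prod measurableSet_Ioi)).2 (.of_forall ?_)
    rintro ⟨b, x⟩ ⟨hb, hx⟩
    exact norm_sabrPhase_mul_sabrTransform_le hT (ha.trans (le_of_lt hb)) hh.le hh' (le_of_lt hx)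

lemma integrableOn_sabrCosTransform {T : ℝ} (hT : 0 < T) :
    IntegrableOn (sabrCosTransform T) (Ioi 0) := by
  have h := (integrable_sabrPhase_mul_sabrTransform hT (h := π / 4) (by positivity)
    (by linarith [Real.pi_pos]) le_rfl).integral_prod_left.re
  refine h.congr ((ae_restrict_iff' measurableSet_Ioi).2 (.of_forall fun b hb => ?_))
  exact (sabrCosTransform_eq hT (le_of_lt hb) (by positivity) (by linarith [Real.pi_pos])).symm

/-- The tail of the cosine transform as a contour integral at height `h`. -/
lemma integral_Ioi_sabrCosTransform {T h a : ℝ} (hT : 0 < T) (hh : 0 < h) (hh' : h < π / 2)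
    (ha : 0 ≤ a) :
    ∫ b in Ioi a, sabrCosTransform T b =
      (∫ x in Ioi (0 : ℝ), Complex.I * sabrPhase a (x + h * Complex.I) /
        Complex.sinh (x + h * Complex.I) * sabrTransform T (x + h * Complex.I)).re := by
  have hi := integrable_sabrPhase_mul_sabrTransform hT hh hh' ha
  have hs : 0 < Real.sin h := Real.sin_pos_of_pos_of_lt_pi hh (by linarith [Real.pi_pos])
  rw [setIntegral_congr_fun measurableSet_Ioi fun b hb =>
    sabrCosTransform_eq hT (ha.trans (le_of_lt hb)) hh.le hh']
  have h1 := integral_re hi.integral_prod_left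
  simp only [RCLike.re_to_complex] at h1
  rw [h1, integral_integral_swap (f := fun b x : ℝ => sabrPhase b (x + h * Complex.I) *
        sabrTransform T (x + h * Complex.I)) hi]
  congr 1
  refine setIntegral_congr_fun measurableSet_Ioi fun x hx => ?_
  rw [integral_mul_const]
  congr 1
  set S := Complex.sinh (x + h * Complex.I) with hS
  have hre : (Complex.I * S).re < 0 := by
    rw [Complex.I_mul_re, hS, Complex.sinh_im, neg_lt_zero]
    have := Real.cosh_pos x
    simp
    positivity
  have hS0 : S ≠ 0 := fun h0 => by simp [h0] at hre
  have := integral_exp_mul_complex_Ioi hre a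
  have e : ∀ b : ℝ, sabrPhase b (x + h * Complex.I) = Complex.exp (Complex.I * S * b) :=
    fun b => by rw [sabrPhase, ← hS, mul_right_comm]
  simp only [e]
  rw [this]
  field_simp
  rw [Complex.I_sq]

lemma continuousWithinAt_sabrTransformReal {T : ℝ} (hT : 0 < T) :
    ContinuousWithinAt (sabrTransformReal T) (Ici 0) 0 := by
  refine continuousWithinAt_of_dominated (bound := fun r => 4 * Real.exp (2 / T + 8 * T) *
      Real.exp (-2 * r)) ?_ ?_ ?_ ?_
  · exact .of_forall fun x => Continuous.aestronglyMeasurable (by fun_prop)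
  · filter_upwards [self_mem_nhdsWithin] with x hx
    refine (ae_restrict_iff' measurableSet_Ioi).2 (.of_forall fun r hr => ?_)
    have hxr : x ≤ x + r := by linarith [mem_Ioi.1 hr]
    rw [Real.norm_of_nonneg (mul_exp_mul_sqrt_nonneg T hx hxr)]
    refine (mul_exp_mul_sqrt_le hT hx hxr).trans ?_
    refine mul_le_mul_of_nonneg_left (Real.exp_le_exp.2 ?_) (by positivity)
    linarith [mem_Ici.1 hx, mem_Ioi.1 hr]
  · exact (integrableOn_exp_mul_Ioi (by norm_num : (-2 : ℝ) < 0) 0).const_mul _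
  · exact .of_forall fun r => Continuous.continuousWithinAt (by fun_prop)

lemma integral_sabrCosTransform {T : ℝ} (hT : 0 < T) :
    ∫ b in Ioi (0 : ℝ), sabrCosTransform T b = π / 2 * sabrTransformReal T 0 := by
  have hW := integrableOn_sabrCosTransform hT
  set C := 4 * Real.exp (2 / T + 8 * T) with hC
  have t1 : Tendsto (fun ε : ℝ => ∫ b in Ioi (0 : ℝ), Real.exp (-ε * b) * sabrCosTransform T b)
      (𝓝[>] 0) (𝓝 (∫ b in Ioi (0 : ℝ), sabrCosTransform T b)) := by
    refine tendsto_integral_filter_of_dominated_convergence (fun b => ‖sabrCosTransform T b‖)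
      ?_ ?_ hW.norm ?_
    · exact .of_forall fun ε => AEStronglyMeasurable.mul
        (Continuous.aestronglyMeasurable (by fun_prop)) hW.aestronglyMeasurable
    · filter_upwards [self_mem_nhdsWithin] with ε hε
      refine (ae_restrict_iff' measurableSet_Ioi).2 (.of_forall fun b hb => ?_)
      rw [norm_mul, Real.norm_of_nonneg (Real.exp_nonneg _)]
      refine mul_le_of_le_one_left (norm_nonneg _) (Real.exp_le_one_iff.2 ?_)
      nlinarith [mem_Ioi.1 hb, mem_Ioi.1 hε]
    · refine .of_forall fun b => ?_
      have : ContinuousAt (fun ε : ℝ => Real.exp (-ε * b) * sabrCosTransform T b) 0 := by fun_prop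
      simpa using this.tendsto.mono_left nhdsWithin_le_nhds
  have heq : ∀ ε ∈ Ioi (0 : ℝ), ∫ b in Ioi (0 : ℝ), Real.exp (-ε * b) * sabrCosTransform T b =
      ∫ z in Ioi (0 : ℝ), (1 + (Real.sinh (ε * z) / ε) ^ 2)⁻¹ * sabrTransformReal T (ε * z) := by
    intro ε hε
    have hi := integrable_mul_cos_mul_sabrTransformReal hT
      (integrableOn_exp_mul_Ioi (neg_lt_zero.2 hε) 0)
    unfold sabrCosTransform
    simp only [← integral_const_mul]
    rw [integral_integral_swap (f := fun b x : ℝ => Real.exp (-ε * b) *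
      (Real.cos (b * Real.sinh x) * sabrTransformReal T x)) hi]
    have := integral_comp_mul_left_Ioi (fun x => ε * ((1 + (Real.sinh x / ε) ^ 2)⁻¹ *
      sabrTransformReal T x)) 0 hε
    have hε0 : ε ≠ 0 := (mem_Ioi.1 hε).ne'
    rw [mul_zero, integral_const_mul, integral_const_mul, smul_eq_mul,
      inv_mul_cancel_left₀ hε0] at this
    have h2 : ∫ x in Ioi (0 : ℝ), (1 + (Real.sinh x / ε) ^ 2)⁻¹ * sabrTransformReal T x =
        ε * ∫ z in Ioi (0 : ℝ), (1 + (Real.sinh (ε * z) / ε) ^ 2)⁻¹ *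
          sabrTransformReal T (ε * z) := this.symm
    rw [← mul_right_inj' hε0, ← h2, ← integral_const_mul]
    refine setIntegral_congr_fun measurableSet_Ioi fun x hx => ?_
    simp only [← mul_assoc]
    rw [integral_mul_const, integral_exp_neg_mul_cos hε, ← mul_assoc]
    congr 1
    field_simp
  have t2 : Tendsto (fun ε : ℝ => ∫ z in Ioi (0 : ℝ), (1 + (Real.sinh (ε * z) / ε) ^ 2)⁻¹ *
      sabrTransformReal T (ε * z)) (𝓝[>] 0)
      (𝓝 (∫ z in Ioi (0 : ℝ), (1 + z ^ 2)⁻¹ * sabrTransformReal T 0)) := by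
    refine tendsto_integral_filter_of_dominated_convergence (fun z => (1 + z ^ 2)⁻¹ * C)
      ?_ ?_ (integrable_inv_one_add_sq.restrict.mul_const _) ?_
    · have := measurable_sabrTransformReal T
      exact .of_forall fun ε => Measurable.aestronglyMeasurable (by fun_prop)
    · filter_upwards [self_mem_nhdsWithin] with ε hε
      have hε : 0 < ε := hε
      refine (ae_restrict_iff' measurableSet_Ioi).2 (.of_forall fun z hz => ?_)
      have hz : 0 < z := hz
      rw [norm_mul, Real.norm_of_nonneg (by positivity)]
      have h1 : z ≤ Real.sinh (ε * z) / ε := by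
        rw [le_div_iff₀ hε, mul_comm]
        exact Real.self_le_sinh_iff.2 (by positivity)
      have h2 : ‖sabrTransformReal T (ε * z)‖ ≤ C := by
        refine (abs_sabrTransformReal_le hT (by positivity)).trans ?_
        refine mul_le_of_le_one_right (by positivity) (Real.exp_le_one_iff.2 ?_)
        have : 0 < ε * z := by positivity
        linarith
      gcongr
    · refine (ae_restrict_iff' measurableSet_Ioi).2 (.of_forall fun z hz => ?_)
      have hz : 0 < z := hz
      refine Tendsto.mul ?_ ?_
      · have hd : HasDerivAt (fun ε => Real.sinh (ε * z)) z 0 := by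
          have := ((hasDerivAt_id (0 : ℝ)).mul_const z).sinh
          simpa using this
        have := hd.tendsto_slope_zero_right
        simp only [zero_add, zero_mul, Real.sinh_zero, sub_zero, smul_eq_mul] at this
        refine ((this.pow 2).const_add 1).inv₀ (by positivity) |>.congr fun ε => ?_
        ring
      · have this : Tendsto (sabrTransformReal T) (𝓝[≥] 0) (𝓝 (sabrTransformReal T 0)) :=
          continuousWithinAt_sabrTransformReal hT
        refine this.comp (tendsto_nhdsWithin_iff.2 ⟨?_, ?_⟩)
        · have : ContinuousAt (fun ε : ℝ => ε * z) 0 := by fun_prop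
          simpa using this.tendsto.mono_left nhdsWithin_le_nhds
        · filter_upwards [self_mem_nhdsWithin] with ε hε
          exact mul_nonneg (le_of_lt hε) hz.le
  have t3 := t1.congr' (eventually_nhdsWithin_of_forall heq)
  rw [tendsto_nhds_unique t3 t2, integral_mul_const, integral_Ioi_inv_one_add_sq]
  simp

lemma sabrTransformReal_zero {T : ℝ} (hT : 0 < T) :
    2 / T * sabrTransformReal T 0 = √(π * T) * Real.exp (T / 8) := by
  rw [← (hasIntegral_exp_mul_sinh_div_sqrt hT le_rfl).2]
  set f : ℝ → ℝ := fun u => Real.exp (-(2 * T)⁻¹ * (u + -T / 2) ^ 2)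
  have hf : Integrable f :=
    (integrable_exp_neg_mul_sq (by positivity : 0 < (2 * T)⁻¹)).comp_add_right (-T / 2)
  have hfv : ∫ u, f u = √(2 * π * T) := by
    have := integral_add_right_eq_self (μ := volume)
      (fun u : ℝ => Real.exp (-(2 * T)⁻¹ * u ^ 2)) (-T / 2)
    rw [this, integral_gaussian]
    congr 1
    field_simp
  have h1 : ∀ u ∈ Ioi (0 : ℝ), Real.exp (-u ^ 2 / (2 * T)) *
      (Real.sinh u / √(Real.cosh u - Real.cosh 0)) =
      √2 / 2 * Real.exp (T / 8) * (f u + f (-u)) := by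
    intro u hu
    have hs : 0 < Real.sinh (u / 2) := Real.sinh_pos_iff.2 (by linarith [mem_Ioi.1 hu])
    have e1 : Real.cosh u - Real.cosh 0 = 2 * Real.sinh (u / 2) ^ 2 := by
      have := Real.cosh_two_mul (u / 2)
      have h3 := Real.cosh_sq (u / 2)
      rw [mul_div_cancel₀ u two_ne_zero] at this
      rw [this, Real.cosh_zero, h3]
      ring
    have e2 : Real.sinh u = 2 * Real.sinh (u / 2) * Real.cosh (u / 2) := by
      rw [← Real.sinh_two_mul]
      ring_nf
    have e3 : f u = Real.exp (-u ^ 2 / (2 * T)) * Real.exp (u / 2) * Real.exp (-(T / 8)) := by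
      simp only [f, ← Real.exp_add]
      congr 1
      field_simp
      ring
    have e4 : f (-u) = Real.exp (-u ^ 2 / (2 * T)) * Real.exp (-(u / 2)) *
        Real.exp (-(T / 8)) := by
      simp only [f, ← Real.exp_add]
      congr 1
      field_simp
      ring
    have e5 : Real.exp (T / 8) * Real.exp (-(T / 8)) = 1 := by
      rw [← Real.exp_add]; simp
    have e6 : √2 * √2 = 2 := Real.mul_self_sqrt (by norm_num)
    rw [e1, e2, e3, e4, Real.sqrt_mul (by norm_num), Real.sqrt_sq hs.le, Real.cosh_eq]
    have h2 : √2 ≠ 0 := by positivity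
    field_simp
    linear_combination (-(√2) ^ 2) * e5 - e6
  rw [setIntegral_congr_fun measurableSet_Ioi h1, integral_const_mul,
    integral_add hf.integrableOn hf.comp_neg.integrableOn, integral_comp_neg_Ioi, neg_zero,
    add_comm, intervalIntegral.integral_Iic_add_Ioi hf.integrableOn hf.integrableOn, hfv,
    show 2 * π * T = 2 * (π * T) by ring, Real.sqrt_mul (by norm_num)]
  have e6 : √2 * √2 = 2 := Real.mul_self_sqrt (by norm_num)
  linear_combination (√(π * T) * Real.exp (T / 8) / 2) * e6

/-- The deficit `1 - V` as a contour integral at height `h`. -/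
lemma one_sub_sabrValue {T a h : ℝ} (hT : 0 < T) (ha : 0 ≤ a) (hh : 0 < h) (hh' : h < π / 2) :
    1 - sabrValue T (2 * a) =
      2 * Real.exp (-T / 8) / (π ^ (3 / 2 : ℝ) * √T) * (2 / T) *
      (∫ x in Ioi (0 : ℝ), Complex.I * sabrPhase a (x + h * Complex.I) /
        Complex.sinh (x + h * Complex.I) * sabrTransform T (x + h * Complex.I)).re := by
  have hW := integrableOn_sabrCosTransform hT
  rw [← integral_Ioi_sabrCosTransform hT hh hh' ha, sabrValue, integral_exp_mul_sabrPayoff hT,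
    integral_sin_mul_sabrTransformReal hT ha]
  have h1 : ∫ b in Ioi (0 : ℝ), sabrCosTransform T b =
      (∫ b in Ioc 0 a, sabrCosTransform T b) + ∫ b in Ioi a, sabrCosTransform T b := by
    rw [← Ioc_union_Ioi_eq_Ioi ha]
    exact setIntegral_union (Ioc_disjoint_Ioi le_rfl) measurableSet_Ioi
      (hW.mono_set Ioc_subset_Ioi_self) (hW.mono_set (Ioi_subset_Ioi ha))
  have h2 : 2 * Real.exp (-T / 8) / (π ^ (3 / 2 : ℝ) * √T) * (2 / T) *
      ∫ b in Ioi (0 : ℝ), sabrCosTransform T b = 1 := by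
    rw [integral_sabrCosTransform hT, mul_assoc, mul_left_comm (2 / T), sabrTransformReal_zero hT]
    have e5 : Real.exp (-(T / 8)) * Real.exp (T / 8) = 1 := by
      rw [← Real.exp_add]; simp
    have e7 : π ^ (3 / 2 : ℝ) = π * √π := by
      rw [Real.sqrt_eq_rpow, show (3 / 2 : ℝ) = 1 + 1 / 2 by norm_num,
        Real.rpow_add Real.pi_pos, Real.rpow_one]
    rw [e7, Real.sqrt_mul Real.pi_pos.le]
    have := Real.pi_pos
    have : √T ≠ 0 := by positivity
    have : √π ≠ 0 := by positivity
    field_simp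
    linear_combination e5
  rw [h1] at h2
  linear_combination (-1 : ℝ) * h2

lemma Complex.sqrt_ofReal_mul {r : ℝ} (hr : 0 < r) (z : ℂ) :
    ((r : ℂ) * z).sqrt = (√r : ℝ) * z.sqrt := by
  rcases eq_or_ne z 0 with rfl | hz
  · simp [Complex.sqrt]
  have hr' : (r : ℂ) ≠ 0 := by exact_mod_cast hr.ne'
  rw [← Complex.sqrt_ofReal_of_nonneg hr.le]
  simp only [Complex.sqrt]
  rw [Complex.cpow_def_of_ne_zero (mul_ne_zero hr' hz), Complex.cpow_def_of_ne_zero hr',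
    Complex.cpow_def_of_ne_zero hz, Complex.log_ofReal_mul hr hz, add_mul, Complex.exp_add,
    Complex.ofReal_log hr.le]

lemma Complex.cosh_add_sub_cosh_sub (p q : ℂ) :
    Complex.cosh (p + q) - Complex.cosh (p - q) = 2 * Complex.sinh p * Complex.sinh q := by
  rw [Complex.cosh_add, Complex.cosh_sub]
  ring

lemma Complex.cosh_sub_cosh_of_re_eq (x y θ : ℝ) :
    Complex.cosh (x + y * Complex.I) - Complex.cosh (x + θ * Complex.I) =
      (2 * Real.sin ((θ - y) / 2) : ℝ) *
        (-Complex.I * Complex.sinh (x + ((θ + y) / 2 : ℝ) * Complex.I)) := by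
  have h := Complex.cosh_add_sub_cosh_sub (x + ((θ + y) / 2 : ℝ) * Complex.I)
    (-(((θ - y) / 2 : ℝ) * Complex.I))
  rw [Complex.sinh_neg, Complex.sinh_mul_I, ← Complex.ofReal_sin] at h
  rw [show (x : ℂ) + y * Complex.I = x + ((θ + y) / 2 : ℝ) * Complex.I +
    -(((θ - y) / 2 : ℝ) * Complex.I) by push_cast; ring,
    show (x : ℂ) + θ * Complex.I = x + ((θ + y) / 2 : ℝ) * Complex.I -
    -(((θ - y) / 2 : ℝ) * Complex.I) by push_cast; ring, h]
  push_cast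
  ring

lemma norm_cosh_sub_cosh_le {x y θ : ℝ} (hy : y ≤ θ) :
    ‖Complex.cosh (x + y * Complex.I) - Complex.cosh (x + θ * Complex.I)‖ ≤
      (θ - y) * Real.cosh x := by
  rw [Complex.cosh_sub_cosh_of_re_eq, norm_mul, norm_mul, norm_neg, Complex.norm_I, one_mul,
    Complex.norm_real]
  have h1 := Complex.norm_sinh_le (x + ((θ + y) / 2 : ℝ) * Complex.I)
  have h2 : ‖2 * Real.sin ((θ - y) / 2)‖ ≤ θ - y := by
    rw [norm_mul, Real.norm_eq_abs, Real.norm_eq_abs]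
    have := Real.abs_sin_le_abs (x := (θ - y) / 2)
    rw [abs_of_nonneg (a := (θ - y) / 2) (by linarith)] at this
    norm_num
    linarith
  have h3 : ((x : ℂ) + ((θ + y) / 2 : ℝ) * Complex.I).re = x := by simp
  rw [h3] at h1
  exact mul_le_mul h2 h1 (norm_nonneg _) (by linarith)

lemma abs_exp_sub_quadratic_le {z : ℝ} (hz : |z| ≤ 1) :
    |Real.exp z - (1 + z + z ^ 2 / 2)| ≤ |z| ^ 3 := by
  have h := Real.exp_bound hz (n := 3) (by norm_num)
  simp only [Finset.sum_range_succ, Finset.sum_range_zero, Nat.factorial] at h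
  norm_num at h
  refine h.trans ?_
  have : 0 ≤ |z| ^ 3 := by positivity
  linarith

lemma tendsto_sq_mul_of_abs_le_cube {f : ℝ → ℝ} (ξ : ℝ)
    (h : ∀ z, |z| ≤ 1 → |f z| ≤ |z| ^ 3) :
    Tendsto (fun r : ℝ => r ^ 2 * f (ξ / r)) atTop (𝓝 0) := by
  have h0 : Tendsto (fun r : ℝ => |ξ| ^ 3 / r) atTop (𝓝 0) := tendsto_id.const_div_atTop _
  refine squeeze_zero_norm' ?_ h0
  filter_upwards [eventually_ge_atTop |ξ|, eventually_gt_atTop 0] with r hr hr0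
  have hz : |ξ / r| ≤ 1 := by
    rw [abs_div, abs_of_pos hr0]
    exact div_le_one_of_le₀ hr hr0.le
  have := h _ hz
  rw [norm_mul, Real.norm_eq_abs, Real.norm_eq_abs, abs_of_nonneg (sq_nonneg r)]
  calc r ^ 2 * |f (ξ / r)| ≤ r ^ 2 * |ξ / r| ^ 3 := by gcongr
    _ = |ξ| ^ 3 / r := by
      rw [abs_div, abs_of_pos hr0]
      field_simp

lemma tendsto_sq_mul_sinh_sub (ξ : ℝ) :
    Tendsto (fun r : ℝ => r ^ 2 * (Real.sinh (ξ / r) - ξ / r)) atTop (𝓝 0) := by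
  refine tendsto_sq_mul_of_abs_le_cube (f := fun z => Real.sinh z - z) ξ fun z hz => ?_
  have h1 := abs_le.1 (abs_exp_sub_quadratic_le hz)
  have h2 := abs_le.1 (abs_exp_sub_quadratic_le (z := -z) (by rwa [abs_neg]))
  rw [abs_neg] at h2
  rw [Real.sinh_eq, abs_le]
  constructor <;> linarith

lemma tendsto_sq_mul_cosh_sub_one (ξ : ℝ) :
    Tendsto (fun r : ℝ => r ^ 2 * (Real.cosh (ξ / r) - 1)) atTop (𝓝 (ξ ^ 2 / 2)) := by
  have := (tendsto_sq_mul_of_abs_le_cube (f := fun z => Real.cosh z - 1 - z ^ 2 / 2) ξ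
    fun z hz => ?_).add_const (ξ ^ 2 / 2)
  · rw [zero_add] at this
    refine this.congr' ?_
    filter_upwards [eventually_gt_atTop 0] with r hr
    field_simp
    ring
  · have h1 := abs_le.1 (abs_exp_sub_quadratic_le hz)
    have h2 := abs_le.1 (abs_exp_sub_quadratic_le (z := -z) (by rwa [abs_neg]))
    rw [abs_neg] at h2
    rw [Real.cosh_eq, abs_le]
    constructor <;> linarith

lemma tendsto_sq_mul_sin (η : ℝ) :
    Tendsto (fun r : ℝ => r ^ 2 * (2 * Real.sin (η / r ^ 2 / 2))) atTop (𝓝 η) := by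
  have h0 : Tendsto (fun r : ℝ => η / r ^ 2 / 2) atTop (𝓝 0) := by
    have : Tendsto (fun r : ℝ => η / r ^ 2) atTop (𝓝 0) :=
      (tendsto_pow_atTop two_ne_zero).const_div_atTop _
    simpa using this.div_const 2
  have h1 := (Real.continuous_sinc.tendsto 0).comp h0
  rw [Real.sinc_zero] at h1
  have h2 := h1.const_mul η
  rw [mul_one] at h2
  refine h2.congr' ?_
  filter_upwards [eventually_gt_atTop 0] with r hr
  rcases eq_or_ne η 0 with rfl | hη
  · simp
  have : η / r ^ 2 / 2 ≠ 0 := by positivity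
  rw [Function.comp, Real.sinc_of_ne_zero this]
  field_simp

lemma one_add_sq_div_two_le_cosh (x : ℝ) : 1 + x ^ 2 / 2 ≤ Real.cosh x := by
  have h1 := Real.cosh_two_mul (x / 2)
  have h2 := Real.cosh_sq (x / 2)
  have h3 : |x / 2| ≤ |Real.sinh (x / 2)| := by
    rw [Real.abs_sinh]
    exact Real.self_le_sinh_iff.2 (abs_nonneg _)
  have h4 := sq_le_sq.2 h3
  rw [mul_div_cancel₀ x two_ne_zero] at h1
  linarith

/-- The exponential rate of `1 - V` in the scaling limit. -/
noncomputable def sabrRate (τ l : ℝ) : ℝ := -(Real.sin l) / 2 + l ^ 2 / (4 * τ)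

/-- The integrand of the vertical part of the contour, rescaled around `s = u = i l`, with
`σ₀ = r ^ 2`. -/
noncomputable def sabrSaddle (τ l r ξ η : ℝ) : ℂ :=
  sabrPhase (r ^ 2 / 2) ((ξ / r : ℝ) + l * Complex.I) /
    Complex.sinh ((ξ / r : ℝ) + l * Complex.I) *
    sabrKernel (2 * τ / r ^ 2) ((ξ / r : ℝ) + l * Complex.I)
      ((ξ / r : ℝ) + (l - η / r ^ 2 : ℝ) * Complex.I) *
    (r * Real.exp (-(r ^ 2 * sabrRate τ l)) : ℝ)

/-- The pointwise limit of `sabrSaddle`. -/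
noncomputable def sabrSaddleLimit (τ l ξ η : ℝ) : ℝ :=
  l / Real.sin l * Real.exp (-(Real.sin l / 4 + 1 / (4 * τ)) * ξ ^ 2) *
    (Real.exp (-(l / (2 * τ) * η)) * √(η * Real.sin l))

lemma sin_le_norm_sinh {x l : ℝ} (hl : 0 < Real.sin l) :
    Real.sin l ≤ ‖Complex.sinh (x + l * Complex.I)‖ := by
  refine le_trans ?_ (Complex.abs_im_le_norm _)
  rw [Complex.sinh_im]
  simp only [Complex.add_re, Complex.ofReal_re, Complex.mul_re, Complex.I_re, mul_zero,
    Complex.ofReal_im, Complex.I_im, mul_one, sub_self, add_zero, Complex.add_im, Complex.mul_im,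
    zero_add]
  refine le_trans ?_ (le_abs_self _)
  exact le_mul_of_one_le_left hl.le (Real.one_le_cosh x)

lemma norm_sabrSaddle_le {τ l r ξ η : ℝ} (hτ : 0 < τ) (hl : 0 < l) (hl' : l < π / 2)
    (hr : 1 ≤ r) (hξ : 0 ≤ ξ) (hη : 0 ≤ η) (hηl : η ≤ l * r ^ 2) :
    ‖sabrSaddle τ l r ξ η‖ ≤ (1 + l) / Real.sin l * Real.exp (8 * τ) *
      Real.exp (-(1 / (8 * τ)) * ξ ^ 2) * (√η * Real.exp (-(l / (4 * τ) * η))) := by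
  have hS : 0 < Real.sin l := Real.sin_pos_of_pos_of_lt_pi hl (by linarith [Real.pi_pos])
  have hr0 : 0 < r := by linarith
  set x := ξ / r with hx
  set y := l - η / r ^ 2 with hy
  have hx0 : 0 ≤ x := by positivity
  have hxξ : x ≤ ξ := div_le_self hξ hr
  have hd : 0 ≤ η / r ^ 2 := by positivity
  have hd' : η / r ^ 2 ≤ l := by rwa [div_le_iff₀ (by positivity)]
  have hyl : y ≤ l := by linarith
  have hy0 : 0 ≤ y := by linarith
  have e1 : ‖Complex.exp (-((x : ℂ) + y * Complex.I) ^ 2 / (2 * (2 * τ / r ^ 2 : ℝ)))‖ =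
      Real.exp (-(r ^ 2 * (x ^ 2 - y ^ 2) / (4 * τ))) := by
    rw [Complex.norm_exp]
    congr 1
    rw [show -((x : ℂ) + y * Complex.I) ^ 2 / (2 * (2 * τ / r ^ 2 : ℝ)) =
      (-(r ^ 2 * (x ^ 2 - y ^ 2) / (4 * τ)) : ℝ) +
        (-(r ^ 2 * (2 * x * y) / (4 * τ)) : ℝ) * Complex.I by
      push_cast
      have : (r : ℂ) ≠ 0 := by exact_mod_cast hr0.ne'
      have : (τ : ℂ) ≠ 0 := by exact_mod_cast hτ.ne'
      field_simp
      ring_nf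
      rw [Complex.I_sq]
      ring]
    rw [Complex.add_re, Complex.ofReal_re, Complex.re_ofReal_mul, Complex.I_re, mul_zero, add_zero]
  have n1 : ‖(x : ℂ) + y * Complex.I‖ ≤ (1 + l) * Real.exp ξ := by
    refine (norm_add_le _ _).trans ?_
    rw [norm_mul, Complex.norm_I, Complex.norm_real, Complex.norm_real,
      Real.norm_of_nonneg hx0, Real.norm_of_nonneg hy0]
    have := Real.add_one_le_exp ξ
    have : l * 1 ≤ l * Real.exp ξ := by gcongr; linarith
    linarith
  have n2 : √‖Complex.cosh (x + y * Complex.I) - Complex.cosh (x + l * Complex.I)‖ ≤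
      √η / r * Real.exp ξ := by
    have h := norm_cosh_sub_cosh_le (x := x) hyl
    have h1 : Real.cosh x ≤ Real.exp ξ ^ 2 := by
      have h2 : Real.cosh x ≤ Real.exp x := by
        rw [Real.cosh_eq]
        have : Real.exp (-x) ≤ Real.exp x := Real.exp_le_exp.2 (by linarith)
        linarith
      refine h2.trans ?_
      rw [← Real.exp_nat_mul]
      exact Real.exp_le_exp.2 (by push_cast; linarith)
    rw [Real.sqrt_le_left (by positivity), mul_pow, div_pow, Real.sq_sqrt hη]
    refine h.trans ?_
    rw [hy, sub_sub_cancel]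
    gcongr
  have n3 : ‖sabrPhase (r ^ 2 / 2) (x + l * Complex.I)‖ ≤ Real.exp (-(r ^ 2 / 2 * Real.sin l)) := by
    rw [norm_sabrPhase]
    refine Real.exp_le_exp.2 (neg_le_neg ?_)
    gcongr
    exact le_mul_of_one_le_left hS.le (Real.one_le_cosh x)
  have n4 := sin_le_norm_sinh (x := x) hS
  have hexp : Real.exp (-(r ^ 2 / 2 * Real.sin l)) *
      (Real.exp ξ * Real.exp (-(r ^ 2 * (x ^ 2 - y ^ 2) / (4 * τ))) * Real.exp ξ) *
      Real.exp (-(r ^ 2 * sabrRate τ l)) ≤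
      Real.exp (8 * τ) * Real.exp (-(1 / (8 * τ)) * ξ ^ 2) * Real.exp (-(l / (4 * τ) * η)) := by
    simp only [← Real.exp_add]
    refine Real.exp_le_exp.2 ?_
    have hx2 : r ^ 2 * x ^ 2 = ξ ^ 2 := by rw [hx]; field_simp
    have hy2 : r ^ 2 * y ^ 2 ≤ r ^ 2 * l ^ 2 - l * η := by
      have : r ^ 2 * y ^ 2 = r ^ 2 * l ^ 2 - 2 * l * η + η * (η / r ^ 2) := by
        rw [hy]; field_simp; ring
      have := mul_le_mul_of_nonneg_left hd' hη
      linarith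
    have k1 : r ^ 2 * (x ^ 2 - y ^ 2) / (4 * τ) ≥ (ξ ^ 2 - r ^ 2 * l ^ 2 + l * η) / (4 * τ) := by
      rw [ge_iff_le]
      gcongr
      linarith
    have k2 : 2 * ξ ≤ 8 * τ + ξ ^ 2 / (8 * τ) := by
      have : 0 ≤ (ξ - 8 * τ) ^ 2 / (8 * τ) := by positivity
      have e : (ξ - 8 * τ) ^ 2 / (8 * τ) = ξ ^ 2 / (8 * τ) - 2 * ξ + 8 * τ := by
        field_simp
        ring
      linarith
    have k3 : (ξ ^ 2 - r ^ 2 * l ^ 2 + l * η) / (4 * τ) = 2 * (ξ ^ 2 / (8 * τ)) -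
        r ^ 2 * (l ^ 2 / (4 * τ)) + l / (4 * τ) * η := by
      field_simp
      ring
    have k4 : 1 / (8 * τ) * ξ ^ 2 = ξ ^ 2 / (8 * τ) := by ring
    rw [sabrRate]
    linarith
  rw [sabrSaddle, sabrKernel, norm_mul, norm_mul, norm_div, norm_mul, norm_mul,
    Complex.norm_sqrt_eq, e1, Complex.norm_real, Real.norm_of_nonneg (by positivity)]
  calc _ ≤ Real.exp (-(r ^ 2 / 2 * Real.sin l)) / Real.sin l *
        ((1 + l) * Real.exp ξ * Real.exp (-(r ^ 2 * (x ^ 2 - y ^ 2) / (4 * τ))) *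
          (√η / r * Real.exp ξ)) * (r * Real.exp (-(r ^ 2 * sabrRate τ l))) := by
        gcongr
    _ = (1 + l) / Real.sin l * √η * (Real.exp (-(r ^ 2 / 2 * Real.sin l)) *
      (Real.exp ξ * Real.exp (-(r ^ 2 * (x ^ 2 - y ^ 2) / (4 * τ))) * Real.exp ξ) *
      Real.exp (-(r ^ 2 * sabrRate τ l))) := by field_simp
    _ ≤ (1 + l) / Real.sin l * √η * _ := mul_le_mul_of_nonneg_left hexp (by positivity)
    _ = _ := by ring

lemma tendsto_sabrSaddle {τ l : ℝ} (hτ : 0 < τ) (hl : 0 < l) (hl' : l < π / 2)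
    (h : l = τ * Real.cos l) (ξ : ℝ) {η : ℝ} (hη : 0 ≤ η) :
    Tendsto (fun r => sabrSaddle τ l r ξ η) atTop (𝓝 (sabrSaddleLimit τ l ξ η : ℝ)) := by
  have hS : 0 < Real.sin l := Real.sin_pos_of_pos_of_lt_pi hl (by linarith [Real.pi_pos])
  have hx : Tendsto (fun r : ℝ => ξ / r) atTop (𝓝 0) := tendsto_id.const_div_atTop _
  have hd : Tendsto (fun r : ℝ => η / r ^ 2) atTop (𝓝 0) :=
    (tendsto_pow_atTop two_ne_zero).const_div_atTop _
  have hxC : Tendsto (fun r : ℝ => ((ξ / r : ℝ) : ℂ)) atTop (𝓝 0) := by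
    have : Tendsto (fun r : ℝ => ((ξ / r : ℝ) : ℂ)) atTop (𝓝 ((0 : ℝ) : ℂ)) :=
      (Complex.continuous_ofReal.tendsto 0).comp hx
    rwa [Complex.ofReal_zero] at this
  have hsinh : Tendsto (fun r : ℝ => Complex.sinh ((ξ / r : ℝ) + l * Complex.I)) atTop
      (𝓝 (Real.sin l * Complex.I)) := by
    have : Tendsto (fun r : ℝ => Complex.sinh ((ξ / r : ℝ) + l * Complex.I)) atTop
        (𝓝 (Complex.sinh (0 + l * Complex.I))) :=
      (Complex.continuous_sinh.tendsto _).comp (hxC.add_const _)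
    rwa [zero_add, Complex.sinh_mul_I, ← Complex.ofReal_sin] at this
  have hu : Tendsto (fun r : ℝ => ((ξ / r : ℝ) : ℂ) + (l - η / r ^ 2 : ℝ) * Complex.I) atTop
      (𝓝 (l * Complex.I)) := by
    have h1 : Tendsto (fun r : ℝ => l - η / r ^ 2) atTop (𝓝 l) := by
      simpa using hd.const_sub l
    have h2 := (Complex.continuous_ofReal.tendsto l).comp h1
    simpa using hxC.add (h2.mul_const Complex.I)
  have hsq : Tendsto (fun r : ℝ => ((r ^ 2 : ℝ) *
      (Complex.cosh ((ξ / r : ℝ) + (l - η / r ^ 2 : ℝ) * Complex.I) -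
        Complex.cosh ((ξ / r : ℝ) + l * Complex.I)) : ℂ).sqrt) atTop
      (𝓝 (√(η * Real.sin l) : ℝ)) := by
    rw [← Complex.sqrt_ofReal_of_nonneg (by positivity)]
    refine (Complex.continuousAt_sqrt_of_re_nonneg
      (by rw [Complex.ofReal_re]; positivity)).tendsto.comp ?_
    have h1 := (Complex.continuous_ofReal.tendsto η).comp (tendsto_sq_mul_sin η)
    have h2 : Tendsto (fun r : ℝ => -Complex.I *
        Complex.sinh ((ξ / r : ℝ) + ((l + (l - η / r ^ 2)) / 2 : ℝ) * Complex.I)) atTop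
        (𝓝 (Real.sin l : ℝ)) := by
      have h3 : Tendsto (fun r : ℝ => (l + (l - η / r ^ 2)) / 2) atTop (𝓝 l) := by
        simpa using ((hd.const_sub l).const_add l).div_const 2
      have h4 := (Complex.continuous_ofReal.tendsto l).comp h3
      have h5 := (Complex.continuous_sinh.tendsto _).comp (hxC.add (h4.mul_const Complex.I))
      have e : -Complex.I * Complex.sinh (0 + l * Complex.I) = (Real.sin l : ℝ) := by
        rw [zero_add, Complex.sinh_mul_I]
        push_cast
        linear_combination (-Complex.sin l) * Complex.I_sq
      rw [← e]
      exact h5.const_mul (-Complex.I)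
    have h3 := h1.mul h2
    rw [← Complex.ofReal_mul] at h3
    refine h3.congr fun r => ?_
    rw [Complex.cosh_sub_cosh_of_re_eq]
    simp only [Function.comp, sub_sub_cancel]
    push_cast
    ring
  have hE : Tendsto (fun r : ℝ => Complex.exp
      ((-(r ^ 2 * (Real.cosh (ξ / r) - 1) * Real.sin l / 2) - ξ ^ 2 / (4 * τ) - l / (2 * τ) * η +
          η * (η / r ^ 2) / (4 * τ) : ℝ) +
        (r ^ 2 * (Real.sinh (ξ / r) - ξ / r) * Real.cos l / 2 + ξ / r * η / (2 * τ) : ℝ) *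
          Complex.I)) atTop
      (𝓝 (Real.exp (-(Real.sin l / 4 + 1 / (4 * τ)) * ξ ^ 2 - l / (2 * τ) * η) : ℝ)) := by
    rw [Complex.ofReal_exp]
    refine (Complex.continuous_exp.tendsto _).comp ?_
    have h1 : Tendsto (fun r : ℝ => -(r ^ 2 * (Real.cosh (ξ / r) - 1) * Real.sin l / 2) -
        ξ ^ 2 / (4 * τ) - l / (2 * τ) * η + η * (η / r ^ 2) / (4 * τ)) atTop
        (𝓝 (-(Real.sin l / 4 + 1 / (4 * τ)) * ξ ^ 2 - l / (2 * τ) * η)) := by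
      have := (((((tendsto_sq_mul_cosh_sub_one ξ).mul_const (Real.sin l)).div_const 2).neg.sub_const
        (ξ ^ 2 / (4 * τ))).sub_const (l / (2 * τ) * η)).add
        ((hd.const_mul η).div_const (4 * τ))
      convert this using 2
      ring
    have h2 : Tendsto (fun r : ℝ => r ^ 2 * (Real.sinh (ξ / r) - ξ / r) * Real.cos l / 2 +
        ξ / r * η / (2 * τ)) atTop (𝓝 0) := by
      have := (((tendsto_sq_mul_sinh_sub ξ).mul_const (Real.cos l)).div_const 2).add
        ((hx.mul_const η).div_const (2 * τ))
      simpa using this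
    have h3 := (Complex.continuous_ofReal.tendsto _).comp h1
    have h4 := ((Complex.continuous_ofReal.tendsto _).comp h2).mul_const Complex.I
    simpa using h3.add h4
  have hne : (Real.sin l * Complex.I : ℂ) ≠ 0 :=
    mul_ne_zero (by exact_mod_cast hS.ne') Complex.I_ne_zero
  have key := ((hE.mul hu).div hsinh hne).mul hsq
  have hlim : (Real.exp (-(Real.sin l / 4 + 1 / (4 * τ)) * ξ ^ 2 - l / (2 * τ) * η) : ℝ) *
      ((l : ℂ) * Complex.I) / (Real.sin l * Complex.I) * (√(η * Real.sin l) : ℝ) =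
      (sabrSaddleLimit τ l ξ η : ℝ) := by
    rw [← mul_assoc, mul_div_mul_right _ _ Complex.I_ne_zero, sabrSaddleLimit, sub_eq_add_neg,
      Real.exp_add]
    push_cast
    ring
  rw [hlim] at key
  refine key.congr' ?_
  filter_upwards [eventually_gt_atTop 0] with r hr
  rw [Complex.sqrt_ofReal_mul (by positivity), Real.sqrt_sq hr.le, sabrSaddle, sabrKernel,
    sabrPhase, sabrRate]
  have hrC : (r : ℂ) ≠ 0 := by exact_mod_cast hr.ne'
  have hτC : (τ : ℂ) ≠ 0 := by exact_mod_cast hτ.ne'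
  have hexp : Complex.exp
      ((-(r ^ 2 * (Real.cosh (ξ / r) - 1) * Real.sin l / 2) - ξ ^ 2 / (4 * τ) - l / (2 * τ) * η +
          η * (η / r ^ 2) / (4 * τ) : ℝ) +
        (r ^ 2 * (Real.sinh (ξ / r) - ξ / r) * Real.cos l / 2 + ξ / r * η / (2 * τ) : ℝ) *
          Complex.I) =
      Complex.exp (Complex.I * (r ^ 2 / 2 : ℝ) * Complex.sinh ((ξ / r : ℝ) + l * Complex.I)) *
      Complex.exp (-(((ξ / r : ℝ) : ℂ) + (l - η / r ^ 2 : ℝ) * Complex.I) ^ 2 /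
        (2 * (2 * τ / r ^ 2 : ℝ))) *
      (Real.exp (-(r ^ 2 * (-(Real.sin l) / 2 + l ^ 2 / (4 * τ)))) : ℝ) := by
    rw [Complex.ofReal_exp, ← Complex.exp_add, ← Complex.exp_add, Complex.sinh_add,
      Complex.cosh_mul_I, Complex.sinh_mul_I]
    congr 1
    have hC : (l : ℂ) = τ * Complex.cos l := by exact_mod_cast h
    have hC' : Complex.cos l = l / τ := by rw [eq_div_iff hτC, mul_comm]; exact hC.symm
    push_cast
    rw [hC']
    field_simp
    ring_nf
    simp only [Complex.I_sq]
    ring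
  simp only [Pi.div_apply]
  rw [hexp]
  push_cast
  ring

lemma measurable_sabrSaddle (τ l r ξ : ℝ) : Measurable (sabrSaddle τ l r ξ) := by
  unfold sabrSaddle
  have := measurable_sabrKernel_comp (2 * τ / r ^ 2)
    (f := fun _ : ℝ => ((ξ / r : ℝ) + l * Complex.I : ℂ))
    (g := fun η : ℝ => ((ξ / r : ℝ) + (l - η / r ^ 2 : ℝ) * Complex.I : ℂ))
    (by fun_prop) (by fun_prop)
  fun_prop

lemma integrableOn_sqrt_mul_exp_neg_mul {b : ℝ} (hb : 0 < b) :
    IntegrableOn (fun η : ℝ => √η * Real.exp (-(b * η))) (Ioi 0) := by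
  have := integrableOn_rpow_mul_exp_neg_mul_rpow (p := 1) (s := 1 / 2) (b := b) (by norm_num)
    (by norm_num) hb
  simpa only [Real.sqrt_eq_rpow, Real.rpow_one, neg_mul] using this

lemma integral_sqrt_mul_exp_neg_mul_pos {b : ℝ} (hb : 0 < b) :
    0 < ∫ η in Ioi (0 : ℝ), √η * Real.exp (-(b * η)) := by
  have := Real.integral_rpow_mul_exp_neg_mul_Ioi (a := 3 / 2) (r := b) (by norm_num) hb
  norm_num at this
  simp only [Real.sqrt_eq_rpow]
  rw [this]
  have := Real.Gamma_pos_of_pos (s := 3 / 2) (by norm_num)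
  positivity

lemma norm_integral_sabrSaddle_le {τ l r ξ : ℝ} (hτ : 0 < τ) (hl : 0 < l) (hl' : l < π / 2)
    (hr : 1 ≤ r) (hξ : 0 ≤ ξ) :
    ‖∫ η in (0 : ℝ)..l * r ^ 2, sabrSaddle τ l r ξ η‖ ≤
      (1 + l) / Real.sin l * Real.exp (8 * τ) * Real.exp (-(1 / (8 * τ)) * ξ ^ 2) *
        ∫ η in Ioi (0 : ℝ), √η * Real.exp (-(l / (4 * τ) * η)) := by
  have hS : 0 < Real.sin l := Real.sin_pos_of_pos_of_lt_pi hl (by linarith [Real.pi_pos])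
  have hi := integrableOn_sqrt_mul_exp_neg_mul (b := l / (4 * τ)) (by positivity)
  rw [intervalIntegral.integral_of_le (by positivity), ← integral_const_mul]
  refine (norm_integral_le_of_norm_le ((hi.mono_set Ioc_subset_Ioi_self).const_mul
    ((1 + l) / Real.sin l * Real.exp (8 * τ) * Real.exp (-(1 / (8 * τ)) * ξ ^ 2))) ?_).trans ?_
  · refine (ae_restrict_iff' measurableSet_Ioc).2 (.of_forall fun η hη => ?_)
    exact norm_sabrSaddle_le hτ hl hl' hr hξ hη.1.le hη.2
  · exact setIntegral_mono_set (hi.const_mul _)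
      (.of_forall fun η => by simp only [Pi.zero_apply]; positivity)
      (.of_forall Ioc_subset_Ioi_self)

lemma tendsto_integral_sabrSaddle {τ l : ℝ} (hτ : 0 < τ) (hl : 0 < l) (hl' : l < π / 2)
    (h : l = τ * Real.cos l) {ξ : ℝ} (hξ : 0 ≤ ξ) :
    Tendsto (fun r => ∫ η in (0 : ℝ)..l * r ^ 2, sabrSaddle τ l r ξ η) atTop
      (𝓝 (∫ η in Ioi (0 : ℝ), (sabrSaddleLimit τ l ξ η : ℂ))) := by
  have hS : 0 < Real.sin l := Real.sin_pos_of_pos_of_lt_pi hl (by linarith [Real.pi_pos])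
  have key : Tendsto (fun r => ∫ η in Ioi (0 : ℝ),
      (Iic (l * r ^ 2)).indicator (sabrSaddle τ l r ξ) η) atTop
      (𝓝 (∫ η in Ioi (0 : ℝ), (sabrSaddleLimit τ l ξ η : ℂ))) := by
    refine tendsto_integral_filter_of_dominated_convergence (fun η =>
      (1 + l) / Real.sin l * Real.exp (8 * τ) * Real.exp (-(1 / (8 * τ)) * ξ ^ 2) *
        (√η * Real.exp (-(l / (4 * τ) * η)))) ?_ ?_ ?_ ?_
    · exact .of_forall fun r =>
        ((measurable_sabrSaddle τ l r ξ).indicator measurableSet_Iic).aestronglyMeasurable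
    · filter_upwards [eventually_ge_atTop 1] with r hr
      refine (ae_restrict_iff' measurableSet_Ioi).2 (.of_forall fun η hη => ?_)
      by_cases hη' : η ∈ Iic (l * r ^ 2)
      · rw [indicator_of_mem hη']
        exact norm_sabrSaddle_le hτ hl hl' hr hξ (le_of_lt hη) hη'
      · rw [indicator_of_notMem hη', norm_zero]
        positivity
    · exact (integrableOn_sqrt_mul_exp_neg_mul (by positivity)).const_mul _
    · refine (ae_restrict_iff' measurableSet_Ioi).2 (.of_forall fun η hη => ?_)
      refine (tendsto_sabrSaddle hτ hl hl' h ξ (le_of_lt hη)).congr' ?_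
      have : Tendsto (fun r : ℝ => l * r ^ 2) atTop atTop :=
        (tendsto_pow_atTop two_ne_zero).const_mul_atTop hl
      filter_upwards [this.eventually_ge_atTop η] with r hr
      rw [indicator_of_mem (mem_Iic.2 hr)]
  refine key.congr fun r => ?_
  rw [setIntegral_indicator measurableSet_Iic, Ioi_inter_Iic,
    intervalIntegral.integral_of_le (by positivity)]

/-- The contour integrand for `1 - V`, rescaled with `σ₀ = r ^ 2`. -/
noncomputable def sabrScaled (τ l r ξ : ℝ) : ℂ :=
  (r ^ 3 * Real.exp (-(r ^ 2 * sabrRate τ l)) : ℝ) *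
    (Complex.I * sabrPhase (r ^ 2 / 2) ((ξ / r : ℝ) + l * Complex.I) /
      Complex.sinh ((ξ / r : ℝ) + l * Complex.I) *
      sabrTransform (2 * τ / r ^ 2) ((ξ / r : ℝ) + l * Complex.I))

/-- The contribution of the real part of the contour to `sabrScaled`. -/
noncomputable def sabrRemainder (τ l r ξ : ℝ) : ℂ :=
  (r ^ 3 * Real.exp (-(r ^ 2 * sabrRate τ l)) : ℝ) *
    (Complex.I * sabrPhase (r ^ 2 / 2) ((ξ / r : ℝ) + l * Complex.I) /
      Complex.sinh ((ξ / r : ℝ) + l * Complex.I) *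
      ∫ t in Ioi (0 : ℝ), sabrKernel (2 * τ / r ^ 2) ((ξ / r : ℝ) + l * Complex.I)
        ((ξ / r + t : ℝ) : ℂ))

lemma sabrScaled_eq {τ l r ξ : ℝ} (hτ : 0 < τ) (hl : 0 < l) (hl' : l < π / 2)
    (hr : 0 < r) (hξ : 0 ≤ ξ) :
    sabrScaled τ l r ξ =
      sabrRemainder τ l r ξ + ∫ η in (0 : ℝ)..l * r ^ 2, sabrSaddle τ l r ξ η := by
  have h1 := intervalIntegral.integral_comp_sub_div (a := 0) (b := l * r ^ 2) (c := r ^ 2)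
    (fun y : ℝ => sabrKernel (2 * τ / r ^ 2) ((ξ / r : ℝ) + l * Complex.I)
      ((ξ / r : ℝ) + y * Complex.I)) (by positivity) l
  rw [mul_div_cancel_right₀ _ (by positivity), sub_self, zero_div, sub_zero] at h1
  have h2 : ∫ η in (0 : ℝ)..l * r ^ 2, sabrSaddle τ l r ξ η =
      sabrPhase (r ^ 2 / 2) ((ξ / r : ℝ) + l * Complex.I) /
        Complex.sinh ((ξ / r : ℝ) + l * Complex.I) *
      (∫ η in (0 : ℝ)..l * r ^ 2, sabrKernel (2 * τ / r ^ 2) ((ξ / r : ℝ) + l * Complex.I)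
        ((ξ / r : ℝ) + (l - η / r ^ 2 : ℝ) * Complex.I)) *
      (r * Real.exp (-(r ^ 2 * sabrRate τ l)) : ℝ) := by
    rw [← intervalIntegral.integral_const_mul, ← intervalIntegral.integral_mul_const]
    rfl
  rw [h2, h1, sabrScaled, sabrRemainder,
    sabrTransform_eq (by positivity) (by positivity) hl.le hl', Complex.real_smul]
  push_cast
  ring_nf
  rw [Complex.I_sq]
  ring

lemma norm_integral_sabrKernel_ofReal_le {τ x r l : ℝ} (hτ : 0 < τ) (hx : 0 ≤ x) (hr : 1 ≤ r) :
    ‖∫ t in Ioi (0 : ℝ), sabrKernel (2 * τ / r ^ 2) (x + l * Complex.I) ((x + t : ℝ) : ℂ)‖ ≤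
      4 * Real.exp (2 / (2 * τ) + 8 * (2 * τ)) := by
  have e := integrableOn_exp_mul_Ioi (by norm_num : (-2 : ℝ) < 0) 0
  have h := norm_integral_le_of_norm_le (f := fun t : ℝ => sabrKernel (2 * τ / r ^ 2)
    (x + l * Complex.I) ((x + t : ℝ) : ℂ))
    (e.const_mul (4 * Real.exp (2 / (2 * τ) + 8 * (2 * τ)))) ?_
  · refine h.trans ?_
    rw [integral_const_mul, integral_exp_mul_Ioi (by norm_num)]
    norm_num
    have := Real.exp_pos (2 / (2 * τ) + 8 * (2 * τ))
    linarith
  · refine (ae_restrict_iff' measurableSet_Ioi).2 (.of_forall fun t ht => ?_)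
    have ht : 0 < t := ht
    have h1 := norm_sabrKernel_le (T := 2 * τ) (s := x + l * Complex.I) (u := ((x + t : ℝ) : ℂ))
      (by positivity) (by simpa using hx) (by simpa using ht.le) (by simp)
    have h2 : ‖sabrKernel (2 * τ / r ^ 2) (x + l * Complex.I) ((x + t : ℝ) : ℂ)‖ ≤
        ‖sabrKernel (2 * τ) (x + l * Complex.I) ((x + t : ℝ) : ℂ)‖ := by
      simp only [sabrKernel, norm_mul]
      gcongr ?_ * ?_ * ?_
      have e1 : ∀ T : ℝ, ‖Complex.exp (-((x + t : ℝ) : ℂ) ^ 2 / (2 * T))‖ =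
          Real.exp (-(x + t) ^ 2 / (2 * T)) := fun T => by
        rw [Complex.norm_exp, ← Complex.ofReal_re (-(x + t) ^ 2 / (2 * T))]
        push_cast
        rfl
      have := e1 (2 * τ)
      have h3 := e1 (2 * τ / r ^ 2)
      push_cast at this h3 ⊢
      rw [this, h3]
      refine Real.exp_le_exp.2 ?_
      rw [neg_div, neg_div]
      refine neg_le_neg ?_
      gcongr
      exact div_le_self (by positivity) (one_le_pow₀ hr)
    refine h2.trans (h1.trans ?_)
    rw [Complex.ofReal_re]
    exact mul_le_mul_of_nonneg_left (Real.exp_le_exp.2 (by linarith)) (by positivity)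

lemma norm_sabrRemainder_le {τ l r ξ : ℝ} (hτ : 0 < τ) (hl : 0 < l) (hl' : l < π / 2)
    (hr : 1 ≤ r) (hξ : 0 ≤ ξ) :
    ‖sabrRemainder τ l r ξ‖ ≤ r ^ 3 * Real.exp (-(l ^ 2 / (4 * τ)) * r) *
      (4 * Real.exp (2 / (2 * τ) + 8 * (2 * τ)) / Real.sin l *
        Real.exp (-(Real.sin l / 4) * ξ ^ 2)) := by
  have hS : 0 < Real.sin l := Real.sin_pos_of_pos_of_lt_pi hl (by linarith [Real.pi_pos])
  have hr0 : 0 < r := by linarith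
  have n1 := norm_integral_sabrKernel_ofReal_le (τ := τ) (x := ξ / r) (l := l) hτ (by positivity) hr
  have n2 := sin_le_norm_sinh (x := ξ / r) hS
  rw [sabrRemainder, norm_mul, norm_mul, norm_div, norm_mul, Complex.norm_I, one_mul,
    Complex.norm_real, Real.norm_of_nonneg (by positivity), norm_sabrPhase]
  have hexp : Real.exp (-(r ^ 2 * sabrRate τ l)) *
      Real.exp (-(r ^ 2 / 2 * (Real.cosh (ξ / r) * Real.sin l))) ≤
      Real.exp (-(l ^ 2 / (4 * τ)) * r) * Real.exp (-(Real.sin l / 4) * ξ ^ 2) := by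
    rw [← Real.exp_add, ← Real.exp_add]
    refine Real.exp_le_exp.2 ?_
    have h1 : r ^ 2 / 2 * ((1 + (ξ / r) ^ 2 / 2) * Real.sin l) ≤
        r ^ 2 / 2 * (Real.cosh (ξ / r) * Real.sin l) := by
      gcongr
      exact one_add_sq_div_two_le_cosh _
    have h2 : r ^ 2 / 2 * ((1 + (ξ / r) ^ 2 / 2) * Real.sin l) =
        r ^ 2 * Real.sin l / 2 + Real.sin l / 4 * ξ ^ 2 := by
      field_simp
      ring
    have h3 : l ^ 2 / (4 * τ) * r ≤ l ^ 2 / (4 * τ) * r ^ 2 := by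
      gcongr
      nlinarith
    rw [sabrRate]
    linarith
  calc _ ≤ r ^ 3 * Real.exp (-(r ^ 2 * sabrRate τ l)) *
        (Real.exp (-(r ^ 2 / 2 * (Real.cosh (ξ / r) * Real.sin l))) / Real.sin l *
          (4 * Real.exp (2 / (2 * τ) + 8 * (2 * τ)))) := by gcongr
    _ = r ^ 3 * (4 * Real.exp (2 / (2 * τ) + 8 * (2 * τ)) / Real.sin l) *
        (Real.exp (-(r ^ 2 * sabrRate τ l)) *
          Real.exp (-(r ^ 2 / 2 * (Real.cosh (ξ / r) * Real.sin l)))) := by ring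
    _ ≤ r ^ 3 * (4 * Real.exp (2 / (2 * τ) + 8 * (2 * τ)) / Real.sin l) * _ :=
        mul_le_mul_of_nonneg_left hexp (by positivity)
    _ = _ := by ring

lemma tendsto_integral_sabrScaled {τ l : ℝ} (hτ : 0 < τ) (hl : 0 < l) (hl' : l < π / 2)
    (h : l = τ * Real.cos l) :
    Tendsto (fun r => ∫ ξ in Ioi (0 : ℝ), sabrScaled τ l r ξ) atTop
      (𝓝 (∫ ξ in Ioi (0 : ℝ), ∫ η in Ioi (0 : ℝ), (sabrSaddleLimit τ l ξ η : ℂ))) := by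
  have hS : 0 < Real.sin l := Real.sin_pos_of_pos_of_lt_pi hl (by linarith [Real.pi_pos])
  have hk : Tendsto (fun r : ℝ => r ^ 3 * Real.exp (-(l ^ 2 / (4 * τ)) * r)) atTop (𝓝 0) := by
    have := tendsto_rpow_mul_exp_neg_mul_atTop_nhds_zero 3 (l ^ 2 / (4 * τ)) (by positivity)
    exact_mod_cast this
  set C := 4 * Real.exp (2 / (2 * τ) + 8 * (2 * τ)) / Real.sin l
  have hC : 0 ≤ C := by positivity
  have hg : ∀ b : ℝ, 0 < b → IntegrableOn (fun ξ : ℝ => Real.exp (-b * ξ ^ 2)) (Ioi 0) :=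
    fun b hb => (integrable_exp_neg_mul_sq hb).integrableOn
  refine tendsto_integral_filter_of_dominated_convergence (fun ξ =>
    C * Real.exp (-(Real.sin l / 4) * ξ ^ 2) +
      (1 + l) / Real.sin l * Real.exp (8 * τ) * Real.exp (-(1 / (8 * τ)) * ξ ^ 2) *
        ∫ η in Ioi (0 : ℝ), √η * Real.exp (-(l / (4 * τ) * η))) ?_ ?_ ?_ ?_
  · refine .of_forall fun r => ?_
    have h1 := (measurable_sabrPhase (r ^ 2 / 2)).comp
      (by fun_prop : Measurable fun ξ : ℝ => ((ξ / r : ℝ) + l * Complex.I : ℂ))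
    have h2 := (stronglyMeasurable_sabrTransform (2 * τ / r ^ 2)).measurable.comp
      (by fun_prop : Measurable fun ξ : ℝ => ((ξ / r : ℝ) + l * Complex.I : ℂ))
    simp only [Function.comp_def] at h1 h2
    have : Measurable (sabrScaled τ l r) := by
      unfold sabrScaled
      exact (((h1.const_mul _).div (by fun_prop)).mul h2).const_mul _
    exact this.aestronglyMeasurable
  · filter_upwards [eventually_ge_atTop 1, hk.eventually_le_const zero_lt_one] with r hr hr'
    refine (ae_restrict_iff' measurableSet_Ioi).2 (.of_forall fun ξ hξ => ?_)
    have hξ : 0 < ξ := hξ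
    rw [sabrScaled_eq hτ hl hl' (by linarith) hξ.le]
    refine (norm_add_le _ _).trans (add_le_add ?_ ?_)
    · refine (norm_sabrRemainder_le hτ hl hl' hr hξ.le).trans ?_
      exact mul_le_of_le_one_left (by positivity) hr'
    · exact norm_integral_sabrSaddle_le hτ hl hl' hr hξ.le
  · exact ((hg _ (by positivity)).const_mul _).add
      (((hg _ (by positivity)).const_mul _).mul_const _)
  · refine (ae_restrict_iff' measurableSet_Ioi).2 (.of_forall fun ξ hξ => ?_)
    have hξ : 0 < ξ := hξ
    have h1 : Tendsto (fun r => sabrRemainder τ l r ξ) atTop (𝓝 0) := by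
      have h2 := hk.mul_const (C * Real.exp (-(Real.sin l / 4) * ξ ^ 2))
      rw [zero_mul] at h2
      refine squeeze_zero_norm' ?_ h2
      filter_upwards [eventually_ge_atTop 1] with r hr
      exact norm_sabrRemainder_le hτ hl hl' hr hξ.le
    have h2 := h1.add (tendsto_integral_sabrSaddle hτ hl hl' h hξ.le)
    rw [zero_add] at h2
    refine h2.congr' ?_
    filter_upwards [eventually_gt_atTop 0] with r hr
    rw [sabrScaled_eq hτ hl hl' hr hξ.le]

lemma integral_sabrSaddleLimit_re_pos {τ l : ℝ} (hτ : 0 < τ) (hl : 0 < l) (hl' : l < π / 2) :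
    0 < (∫ ξ in Ioi (0 : ℝ), ∫ η in Ioi (0 : ℝ), (sabrSaddleLimit τ l ξ η : ℂ)).re := by
  have hS : 0 < Real.sin l := Real.sin_pos_of_pos_of_lt_pi hl (by linarith [Real.pi_pos])
  have h1 : ∀ ξ : ℝ, ∫ η in Ioi (0 : ℝ), sabrSaddleLimit τ l ξ η =
      Real.exp (-(Real.sin l / 4 + 1 / (4 * τ)) * ξ ^ 2) * (l / Real.sin l * √(Real.sin l) *
        ∫ η in Ioi (0 : ℝ), √η * Real.exp (-(l / (2 * τ) * η))) := by
    intro ξ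
    rw [← integral_const_mul, ← integral_const_mul]
    refine setIntegral_congr_fun measurableSet_Ioi fun η hη => ?_
    simp only [sabrSaddleLimit]
    rw [Real.sqrt_mul (le_of_lt hη)]
    ring
  simp only [integral_complex_ofReal]
  rw [Complex.ofReal_re]
  simp only [h1]
  rw [integral_mul_const, integral_gaussian_Ioi]
  have h2 := integral_sqrt_mul_exp_neg_mul_pos (b := l / (2 * τ)) (by positivity)
  have := Real.pi_pos
  positivity

lemma one_sub_sabrValue_eq {τ l r : ℝ} (hτ : 0 < τ) (hl : 0 < l) (hl' : l < π / 2) (hr : 0 < r) :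
    1 - sabrValue (2 * τ / r ^ 2) (r ^ 2) =
      Real.exp (r ^ 2 * sabrRate τ l) * (r⁻¹ *
        (Real.exp (-(τ / 4 / r ^ 2)) * (2 / (π ^ (3 / 2 : ℝ) * √(2 * τ) * τ)) *
          (∫ ξ in Ioi (0 : ℝ), sabrScaled τ l r ξ).re)) := by
  have h1 := one_sub_sabrValue (T := 2 * τ / r ^ 2) (a := r ^ 2 / 2) (by positivity)
    (by positivity) hl hl'
  rw [mul_div_cancel₀ _ two_ne_zero] at h1
  have h2 := integral_comp_mul_right_Ioi (fun x : ℝ => Complex.I *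
    sabrPhase (r ^ 2 / 2) (x + l * Complex.I) / Complex.sinh (x + l * Complex.I) *
    sabrTransform (2 * τ / r ^ 2) (x + l * Complex.I)) 0 (inv_pos.2 hr)
  simp only [← div_eq_mul_inv, inv_inv, zero_div] at h2
  simp only [sabrScaled]
  rw [h1, integral_const_mul, h2, Complex.re_ofReal_mul, Complex.real_smul,
    Complex.re_ofReal_mul, Real.sqrt_div (by positivity), Real.sqrt_sq hr.le]
  have e1 : Real.exp (-(2 * τ / r ^ 2) / 8) = Real.exp (-(τ / 4 / r ^ 2)) := by
    congr 1
    field_simp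
    norm_num
  have e2 : Real.exp (r ^ 2 * sabrRate τ l) * Real.exp (-(r ^ 2 * sabrRate τ l)) = 1 := by
    rw [← Real.exp_add]
    simp
  rw [e1]
  set J := (∫ x in Ioi (0 : ℝ), Complex.I *
    sabrPhase (r ^ 2 / 2) (x + l * Complex.I) / Complex.sinh (x + l * Complex.I) *
    sabrTransform (2 * τ / r ^ 2) (x + l * Complex.I)).re
  have h3 : π ^ (3 / 2 : ℝ) ≠ 0 := (Real.rpow_pos_of_pos Real.pi_pos _).ne'
  have h4 : √(2 * τ) ≠ 0 := by positivity
  calc _ = Real.exp (-(τ / 4 / r ^ 2)) * 2 * r ^ 3 / (π ^ (3 / 2 : ℝ) * √(2 * τ) * τ) * J * 1 := by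
        field_simp
    _ = _ := by
        rw [← e2]
        field_simp

lemma tendsto_log_one_sub_sabrValue_sq {τ l : ℝ} (hτ : 0 < τ) (hl : 0 < l) (hl' : l < π / 2)
    (h : l = τ * Real.cos l) :
    Tendsto (fun r : ℝ => 1 / r ^ 2 * Real.log (1 - sabrValue (2 * τ / r ^ 2) (r ^ 2))) atTop
      (𝓝 (sabrRate τ l)) := by
  have hsq : Tendsto (fun r : ℝ => r ^ 2) atTop atTop := tendsto_pow_atTop two_ne_zero
  set K := (∫ ξ in Ioi (0 : ℝ), ∫ η in Ioi (0 : ℝ), (sabrSaddleLimit τ l ξ η : ℂ)).re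
  have hK : 0 < K := integral_sabrSaddleLimit_re_pos hτ hl hl'
  set c := 2 / (π ^ (3 / 2 : ℝ) * √(2 * τ) * τ)
  have hc : 0 < c := by
    have := Real.rpow_pos_of_pos Real.pi_pos (3 / 2)
    positivity
  set Q : ℝ → ℝ := fun r => Real.exp (-(τ / 4 / r ^ 2)) * c *
    (∫ ξ in Ioi (0 : ℝ), sabrScaled τ l r ξ).re
  have hQ : Tendsto Q atTop (𝓝 (c * K)) := by
    have h1 : Tendsto (fun r : ℝ => Real.exp (-(τ / 4 / r ^ 2))) atTop (𝓝 1) := by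
      have h2 : Tendsto (fun r : ℝ => -(τ / 4 / r ^ 2)) atTop (𝓝 0) := by
        simpa using (hsq.const_div_atTop (τ / 4)).neg
      simpa only [Real.exp_zero] using h2.rexp
    have h3 := (Complex.continuous_re.tendsto _).comp (tendsto_integral_sabrScaled hτ hl hl' h)
    simpa using (h1.mul_const c).mul h3
  have hQ0 : 0 < c * K := mul_pos hc hK
  have hlogQ : Tendsto (fun r => Real.log (Q r) / r ^ 2) atTop (𝓝 0) :=
    (hQ.log hQ0.ne').div_atTop hsq
  have hlog : Tendsto (fun r : ℝ => Real.log r / r ^ 2) atTop (𝓝 0) := by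
    have := Real.isLittleO_log_id_atTop.tendsto_div_nhds_zero.mul
      (tendsto_inv_atTop_zero (𝕜 := ℝ))
    rw [zero_mul] at this
    refine this.congr fun r => ?_
    simp only [id]
    rw [sq, div_mul_eq_div_div, div_eq_mul_inv (Real.log r / r)]
  have key := (hlogQ.sub hlog).const_add (sabrRate τ l)
  rw [sub_zero, add_zero] at key
  refine key.congr' ?_
  filter_upwards [eventually_gt_atTop 0, hQ.eventually_const_lt hQ0] with r hr hQr
  rw [one_sub_sabrValue_eq hτ hl hl' hr, Real.log_mul (Real.exp_pos _).ne' (by positivity),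
    Real.log_mul (by positivity) hQr.ne', Real.log_exp, Real.log_inv]
  field_simp
  ring

/-- Large-volatility scaling limit: for fixed `τ > 0`, with `λ ∈ (0, π/2)` the unique
solution of `λ / cos λ = τ` and `Σ̂²(τ) = sin(2λ)/λ − (1 + cos 2λ)/2`,
`lim_{σ₀→∞} (1/σ₀) log(1 − V(2τ/σ₀, σ₀)) = −(τ/4) Σ̂²(τ)`. -/
theorem sabr_scaling_limit (τ : ℝ) (hτ : 0 < τ)
    (lam : ℝ) (hlam : lam ∈ Set.Ioo (0 : ℝ) (π / 2))
    (hlameq : lam / Real.cos lam = τ) :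
    Filter.Tendsto
      (fun σ₀ : ℝ => 1 / σ₀ * Real.log (1 - sabrValue (2 * τ / σ₀) σ₀))
      Filter.atTop
      (nhds (-(τ / 4) *
        (Real.sin (2 * lam) / lam - (1 + Real.cos (2 * lam)) / 2))) := by
  have hl := hlam.1
  have hcos : 0 < Real.cos lam := Real.cos_pos_of_mem_Ioo ⟨by linarith [Real.pi_pos], hlam.2⟩
  have h : lam = τ * Real.cos lam := (div_eq_iff hcos.ne').1 hlameq
  have hrate : -(τ / 4) * (Real.sin (2 * lam) / lam - (1 + Real.cos (2 * lam)) / 2) =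
      sabrRate τ lam := by
    rw [sabrRate, Real.sin_two_mul, Real.cos_two_mul, ← hlameq]
    field_simp
    ring
  rw [hrate]
  have hsqrt : Tendsto (fun σ : ℝ => √σ) atTop atTop := Real.tendsto_sqrt_atTop
  refine ((tendsto_log_one_sub_sabrValue_sq hτ hl hlam.2 h).comp hsqrt).congr' ?_
  filter_upwards [eventually_ge_atTop 0] with σ hσ
  simp only [Function.comp, Real.sq_sqrt hσ]
end
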